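/- Every 2-connected claw-o-heavy and P6-γ2-heavy graph is hamiltonian, where γ2 is the graph (with loops) on I = {1,2,3,4,5,6} with edge set E(γ2) = {11,12,14,15,16,25,26,36,56,66}. -/

import Mathlib

/-- A graph is 2-connected if it has at least 3 vertices and deleting any
single vertex leaves a connected graph. -/
def TwoConnected {V : Type*} [Fintype V] (G : SimpleGraph V) : Prop :=
  3 ≤ Fintype.card V ∧ ∀ v : V, (G.induce ({v}ᶜ : Set V)).Connected

/-- A graph `G` of order `n` is claw-o-heavy if every induced copy of the claw `K_{1,3}`
(with center `a` and leaves `b₁, b₂, b₃`) contains two nonadjacent vertices whose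
degree sum in `G` is at least `n`. -/
def ClawOHeavy {V : Type*} [Fintype V] (G : SimpleGraph V) [DecidableRel G.Adj] : Prop :=
  ∀ a b₁ b₂ b₃ : V, b₁ ≠ b₂ → b₁ ≠ b₃ → b₂ ≠ b₃ →
    G.Adj a b₁ → G.Adj a b₂ → G.Adj a b₃ →
    ¬ G.Adj b₁ b₂ → ¬ G.Adj b₁ b₃ → ¬ G.Adj b₂ b₃ →
    ∃ u v : V, u ∈ ({a, b₁, b₂, b₃} : Set V) ∧ v ∈ ({a, b₁, b₂, b₃} : Set V) ∧
      u ≠ v ∧ ¬ G.Adj u v ∧ Fintype.card V ≤ G.degree u + G.degree v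

/-- `v 0, v 1, …, v 5` is an induced path on 6 vertices in `G`. -/
def IsInducedP6 {V : Type*} (G : SimpleGraph V) (v : Fin 6 → V) : Prop :=
  Function.Injective v ∧
    ∀ i j : Fin 6, G.Adj (v i) (v j) ↔ (i.val + 1 = j.val ∨ j.val + 1 = i.val)

/- The paper indexes the vertices of `P₆` by `I = {1,…,6}`; here we use `Fin 6 = {0,…,5}`
(so paper-index `i` corresponds to `i - 1 : Fin 6`).  A graph (possibly with loops) on `I`
is modelled as a set of unordered pairs (`Sym2 (Fin 6)`); a loop at `i` is `s(i, i)`. -/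

/-- `γ` is symmetrical: `ij ∈ E(γ)` iff `(7-i)(7-j) ∈ E(γ)` (in `Fin 6` terms,
the map `i ↦ 7 - i` on `{1,…,6}` is `Fin.rev : i ↦ 5 - i`). -/
def SymmetricalGamma (γ : Set (Sym2 (Fin 6))) : Prop :=
  ∀ e : Sym2 (Fin 6), e ∈ γ ↔ e.map Fin.rev ∈ γ

/-- A graph `G` of order `n` is `P₆`-`γ`-heavy if for every induced path
`v 0, …, v 5` on 6 vertices there is an edge (or loop) `ij` of `γ` with
`d(v i) + d(v j) ≥ n`. -/
def P6GammaHeavy {V : Type*} [Fintype V] (G : SimpleGraph V) [DecidableRel G.Adj]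
    (γ : Set (Sym2 (Fin 6))) : Prop :=
  ∀ v : Fin 6 → V, IsInducedP6 G v →
    ∃ i j : Fin 6, s(i, j) ∈ γ ∧ Fintype.card V ≤ G.degree (v i) + G.degree (v j)

/-- `γ₁`, with paper edge set `{14,15,16,24,25,26,34,35,36}`. -/
def gamma1 : Set (Sym2 (Fin 6)) :=
  {s(0,3), s(0,4), s(0,5), s(1,3), s(1,4), s(1,5), s(2,3), s(2,4), s(2,5)}

/-- `γ₂`, with paper edge set `{11,12,14,15,16,25,26,36,56,66}`. -/
def gamma2 : Set (Sym2 (Fin 6)) :=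
  {s(0,0), s(0,1), s(0,3), s(0,4), s(0,5), s(1,4), s(1,5), s(2,5), s(4,5), s(5,5)}

/-- `γ₃`, with paper edge set `{13,14,15,25,26,36,46}`. -/
def gamma3 : Set (Sym2 (Fin 6)) :=
  {s(0,2), s(0,3), s(0,4), s(1,4), s(1,5), s(2,5), s(3,5)}

/-- `l` is a walk of `E`, written as the list of its vertices, from `a` to `b`. -/
structure Seg {V : Type*} (E : SimpleGraph V) (a b : V) (l : List V) : Prop where
  chain : l.IsChain E.Adj
  head : l.head? = some a
  last : l.getLast? = some b

namespace Seg

variable {V : Type*} {E F : SimpleGraph V} {a b c d x : V} {l l' : List V}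

theorem single (a : V) : Seg E a a [a] := ⟨by simp, rfl, rfl⟩

theorem append (h : Seg E a b l) (h' : Seg E c d l') (hbc : E.Adj b c) :
    Seg E a d (l ++ l') := by
  refine ⟨List.isChain_append.2 ⟨h.chain, h'.chain, ?_⟩, ?_, ?_⟩
  · simp [h.last, h'.head, hbc]
  · simp [List.head?_append, h.head]
  · simp [List.getLast?_append, h'.last]

theorem reverse (h : Seg E a b l) : Seg E b a l.reverse := by
  refine ⟨List.isChain_reverse.2 (h.chain.imp fun _ _ h => h.symm), ?_, ?_⟩
  · simp [h.last]
  · simp [h.head]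

theorem mono (hEF : E ≤ F) (h : Seg E a b l) : Seg F a b l :=
  ⟨h.chain.imp fun _ _ h => hEF h, h.head, h.last⟩

theorem head_mem (h : Seg E a b l) : a ∈ l := List.mem_of_head? h.head

theorem last_mem (h : Seg E a b l) : b ∈ l := List.mem_of_getLast? h.last

theorem split (h : Seg E a b (l ++ l')) (hl : l ≠ []) (hl' : l' ≠ []) :
    ∃ c d, Seg E a c l ∧ Seg E d b l' ∧ E.Adj c d := by
  obtain ⟨h1, h2, h3⟩ := List.isChain_append.1 h.chain
  obtain ⟨c, hc⟩ : ∃ c, l.getLast? = some c := ⟨_, List.getLast?_eq_some_getLast hl⟩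
  obtain ⟨d, hd⟩ : ∃ d, l'.head? = some d := ⟨_, List.head?_eq_some_head hl'⟩
  refine ⟨c, d, ⟨h1, ?_, hc⟩, ⟨h2, hd, ?_⟩, h3 c hc d hd⟩
  · have := h.head
    rwa [List.head?_append_of_ne_nil _ hl] at this
  · have := h.last
    rwa [List.getLast?_append_of_ne_nil _ hl'] at this

/-- Splitting off the part before a vertex other than the first one. -/
theorem split_at (h : Seg E a b l) (hx : x ∈ l) (hxa : x ≠ a) :
    ∃ A B c, l = A ++ B ∧ Seg E a c A ∧ Seg E x b B ∧ E.Adj c x := by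
  obtain ⟨A, B, rfl⟩ := List.append_of_mem hx
  have hA : A ≠ [] := by
    rintro rfl
    have := h.head
    simp at this
    exact hxa this
  obtain ⟨c, d, h1, h2, h3⟩ := h.split hA (by simp)
  have : d = x := by have := h2.head; simp at this; exact this.symm
  subst this
  exact ⟨A, d :: B, c, rfl, h1, h2, h3⟩

/-- Splitting off the first vertex. -/
theorem split_head (h : Seg E a b l) (hab : a ≠ b) :
    ∃ c B, l = [a] ++ B ∧ Seg E c b B ∧ E.Adj a c := by
  rcases l with _ | ⟨u, t⟩
  · simpa using h.head
  have hu : u = a := by simpa using h.head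
  subst hu
  have ht : t ≠ [] := by
    rintro rfl
    exact hab (by simpa using h.last)
  obtain ⟨c, d, h1, h2, h3⟩ := Seg.split (l := [u]) (l' := t) h (by simp) ht
  have : c = u := by simpa using h1.last.symm
  subst this
  exact ⟨d, t, rfl, h2, h3⟩

end Seg

/-- A list is spanning if it contains every vertex exactly once. -/
def Spanning {V : Type*} (l : List V) : Prop := l.Nodup ∧ ∀ v, v ∈ l

theorem Spanning.perm {V : Type*} {l l' : List V} (h : Spanning l) (hp : l.Perm l') :
    Spanning l' :=
  ⟨hp.nodup_iff.1 h.1, fun v => hp.mem_iff.1 (h.2 v)⟩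

/-- Hamiltonicity, in terms of lists of vertices. -/
def HamL {V : Type*} (E : SimpleGraph V) : Prop :=
  ∃ a b l, Seg E a b l ∧ Spanning l ∧ E.Adj b a

theorem HamL.mono {V : Type*} {E F : SimpleGraph V} (hEF : E ≤ F) (h : HamL E) : HamL F := by
  obtain ⟨a, b, l, h1, h2, h3⟩ := h
  exact ⟨a, b, l, h1.mono hEF, h2, hEF h3⟩

/-- A Hamilton cycle may be started at any vertex. -/
theorem HamL.rotate {V : Type*} {E : SimpleGraph V} (h : HamL E) (x : V) :
    ∃ b l, Seg E x b l ∧ Spanning l ∧ E.Adj b x := by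
  obtain ⟨a, b, l, h1, h2, h3⟩ := h
  by_cases hx : x = a
  · exact ⟨b, l, hx ▸ h1, h2, hx ▸ h3⟩
  obtain ⟨A, B, c, rfl, hA, hB, hc⟩ := h1.split_at (h2.2 x) hx
  exact ⟨c, B ++ A, hB.append hA h3, h2.perm List.perm_append_comm, hc⟩

/-- Degree, without decidability assumptions. -/
noncomputable def dg {V : Type*} (F : SimpleGraph V) (v : V) : ℕ := (F.neighborSet v).ncard

theorem dg_mono {V : Type*} [Finite V] {F F' : SimpleGraph V} (h : F ≤ F') (v : V) :
    dg F v ≤ dg F' v :=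
  Set.ncard_le_ncard (fun _ hw => h hw) (Set.toFinite _)

/-- Crossing pairs in a list. -/
theorem exists_crossing_of_count {V : Type*} (P Q : V → Bool) (l : List V) (hl : l ≠ [])
    (h : l.length ≤ l.tail.countP P + l.dropLast.countP Q) :
    ∃ A c c' B, l = A ++ c :: c' :: B ∧ Q c ∧ P c' := by
  induction l with
  | nil => exact absurd rfl hl
  | cons a t ih =>
    rcases t with _ | ⟨b, t⟩
    · simp at h
    by_cases hab : Q a ∧ P b
    · exact ⟨[], a, b, t, rfl, hab.1, hab.2⟩
    · obtain ⟨A, c, c', B, h1, h2, h3⟩ := ih (by simp) (by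
        simp only [List.tail_cons, List.dropLast_cons_cons, List.countP_cons,
          List.length_cons] at h ⊢
        have : (if P b = true then 1 else 0) + (if Q a = true then 1 else 0) ≤ 1 := by
          by_cases h1 : P b = true <;> by_cases h2 : Q a = true <;> simp_all
        omega)
      exact ⟨a :: A, c, c', B, by simp [h1], h2, h3⟩

theorem Spanning.length {V : Type*} [Fintype V] {l : List V} (h : Spanning l) :
    l.length = Fintype.card V := by
  classical
  rw [← List.toFinset_card_of_nodup h.1, ← Finset.card_univ]
  congr 1
  ext v
  simp [h.2]

theorem Spanning.countP_eq {V : Type*} {l : List V} (h : Spanning l) (P : V → Bool) :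
    l.countP P = {v | P v}.ncard := by
  classical
  rw [List.countP_eq_length_filter, ← List.toFinset_card_of_nodup (h.1.filter _),
    ← Set.ncard_coe_finset]
  congr 1
  ext v
  simp [h.2]

theorem ham_of_path_of_heavy {V : Type*} [Fintype V] {F : SimpleGraph V} {x y : V} {l : List V}
    (hl : Seg F x y l) (hs : Spanning l)
    (hd : Fintype.card V ≤ dg F x + dg F y) : HamL F := by
  classical
  have hne : l ≠ [] := by rintro rfl; simpa using hl.head
  have h1 : l.tail.countP (fun v => decide (F.Adj x v)) = dg F x := by
    have := hs.countP_eq (fun v => decide (F.Adj x v))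
    rw [dg, SimpleGraph.neighborSet]
    simp only [decide_eq_true_eq] at this
    rw [← this]
    conv_rhs => rw [List.eq_cons_of_mem_head? hl.head]
    simp
  have h2 : l.dropLast.countP (fun v => decide (F.Adj y v)) = dg F y := by
    have := hs.countP_eq (fun v => decide (F.Adj y v))
    rw [dg, SimpleGraph.neighborSet]
    simp only [decide_eq_true_eq] at this
    rw [← this]
    conv_rhs => rw [← List.dropLast_append_getLast? y hl.last]
    simp
  obtain ⟨A, c, c', B, rfl, h3, h4⟩ := exists_crossing_of_count (fun v => decide (F.Adj x v))
    (fun v => decide (F.Adj y v)) l hne (by rw [h1, h2, hs.length]; exact hd)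
  simp only [decide_eq_true_eq] at h3 h4
  have hl' : Seg F x y ((A ++ [c]) ++ (c' :: B)) := by simpa using hl
  obtain ⟨e, f, h5, h6, h7⟩ := hl'.split (by simp) (by simp)
  have he : e = c := by simpa using h5.last.symm
  have hf : f = c' := by simpa using h6.head.symm
  subst he hf
  refine ⟨x, f, _, h5.append h6.reverse h3.symm, hs.perm ?_, h4.symm⟩
  have : A ++ e :: f :: B = (A ++ [e]) ++ (f :: B) := by simp
  rw [this]
  exact (List.reverse_perm _).symm.append_left _

theorem ham_path_of_ham_edge {V : Type*} [Fintype V] {F : SimpleGraph V} {x y : V}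
    (h3 : 3 ≤ Fintype.card V)
    (h : HamL (F ⊔ SimpleGraph.edge x y)) (hF : ¬ HamL F) :
    ∃ l, Seg F x y l ∧ Spanning l := by
  obtain ⟨w, l, h1, h2, hwx⟩ := h.rotate x
  obtain ⟨u, t, rfl, ht, hxu⟩ := h1.split_head hwx.ne'
  have hxt : x ∉ t := by have := h2.1; simp at this; exact this.1
  have ht' : Seg F u w t := by
    refine ⟨?_, ht.head, ht.last⟩
    have := ht.chain
    rw [List.isChain_iff_forall_rel_of_append_cons_cons] at this ⊢
    intro a b l₁ l₂ hl
    have hab := this hl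
    have ha : a ≠ x := by rintro rfl; exact hxt (by simp [hl])
    have hb : b ≠ x := by rintro rfl; exact hxt (by simp [hl])
    simp [SimpleGraph.edge_adj, ha, hb] at hab
    exact hab
  have hp : Spanning (t ++ [x]) := h2.perm List.perm_append_comm
  have huw : u ≠ w := by
    rintro rfl
    have hlen := h2.length
    rcases t with _ | ⟨a, _ | ⟨b, t⟩⟩
    · simp at hlen; omega
    · simp at hlen; omega
    · have h4 := ht.head
      have h5 := ht.last
      have h6 := h2.1
      simp at h4
      subst h4
      have h7 : a ∈ b :: t := List.mem_of_getLast? (by simpa [List.getLast?_cons_cons] using h5)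
      simp at h6 h7
      tauto
  simp only [SimpleGraph.sup_adj, SimpleGraph.edge_adj] at hwx hxu
  by_cases hx1 : F.Adj x u
  · by_cases hw1 : F.Adj w x
    · exact absurd ⟨x, w, _, (Seg.single x).append ht' hx1, h2, hw1⟩ hF
    · have : w = y := by
        have := ht.last_mem
        rcases hwx with h | ⟨h | h, -⟩
        · exact absurd h hw1
        · exact absurd (h.1 ▸ this) hxt
        · exact h.1
      exact ⟨_, this ▸ (Seg.single x).append ht' hx1, h2⟩
  · have : u = y := by
        have := ht.head_mem
        rcases hxu with h | ⟨h | h, -⟩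
        · exact absurd h hx1
        · exact h.2
        · exact absurd (h.2 ▸ this) hxt
    have hw1 : F.Adj w x := by
      have := ht.last_mem
      rcases hwx with h | ⟨h | h, -⟩
      · exact h
      · exact absurd (h.1 ▸ this) hxt
      · exact absurd (by simp_all) huw
    subst this
    refine ⟨([x] ++ t.reverse), (Seg.single x).append ht'.reverse hw1.symm, h2.perm ?_⟩
    exact (List.reverse_perm _).symm.append_left _

/-- The Bondy–Chvátal closure step. -/
theorem not_ham_sup_edge {V : Type*} [Fintype V] {F : SimpleGraph V} {x y : V}
    (h3 : 3 ≤ Fintype.card V) (hF : ¬ HamL F) (hd : Fintype.card V ≤ dg F x + dg F y) :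
    ¬ HamL (F ⊔ SimpleGraph.edge x y) := by
  intro h
  obtain ⟨l, h1, h2⟩ := ham_path_of_ham_edge h3 h hF
  exact hF (ham_of_path_of_heavy h1 h2 hd)

/-- Two vertices are related if they are adjacent or their degree sum is large. -/
def oGraph {V : Type*} [Fintype V] (F : SimpleGraph V) : SimpleGraph V where
  Adj u v := F.Adj u v ∨ u ≠ v ∧ Fintype.card V ≤ dg F u + dg F v
  symm := ⟨fun u v h => h.imp (fun h => h.symm) fun h => ⟨h.1.symm, by rw [add_comm]; exact h.2⟩⟩
  loopless := ⟨fun u h => by rcases h with h | h; exacts [F.loopless.irrefl _ h, h.1 rfl]⟩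

theorem le_oGraph {V : Type*} [Fintype V] (F : SimpleGraph V) : F ≤ oGraph F :=
  fun _ _ h => Or.inl h

theorem oGraph_mono {V : Type*} [Fintype V] {F F' : SimpleGraph V} (h : F ≤ F') :
    oGraph F ≤ oGraph F' := fun u v huv => huv.imp (fun e => h e) fun e =>
  ⟨e.1, e.2.trans (Nat.add_le_add (dg_mono h u) (dg_mono h v))⟩

/-- A nonhamiltonian graph lies below a maximal one among those below `E`. -/
theorem exists_maximal_not_ham {V : Type*} [Fintype V] {F E : SimpleGraph V} (hFE : F ≤ E)
    (hF : ¬ HamL F) : ∃ F', F ≤ F' ∧ F' ≤ E ∧ ¬ HamL F' ∧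
      ∀ u v, E.Adj u v → ¬ HamL (F' ⊔ SimpleGraph.edge u v) → F'.Adj u v := by
  obtain ⟨M, hFM, hM⟩ := Set.Finite.exists_le_maximal
    (s := {M : SimpleGraph V | F ≤ M ∧ M ≤ E ∧ ¬ HamL M}) (Set.toFinite _) ⟨le_rfl, hFE, hF⟩
  refine ⟨M, hFM, hM.prop.2.1, hM.prop.2.2, fun u v huv hn => ?_⟩
  have : M ⊔ SimpleGraph.edge u v ≤ M :=
    hM.le_of_ge ⟨hM.prop.1.trans le_sup_left, sup_le hM.prop.2.1
      (by rw [SimpleGraph.edge_le_iff]; exact Or.inr huv), hn⟩ le_sup_left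
  exact this (Or.inr (by simp [SimpleGraph.edge_adj, huv.ne]))

theorem not_ham_oGraph {V : Type*} [Fintype V] {F : SimpleGraph V}
    (h3 : 3 ≤ Fintype.card V) (hF : ¬ HamL F) : ¬ HamL (oGraph F) := by
  obtain ⟨M, hFM, hME, hM, hmax⟩ := exists_maximal_not_ham (le_oGraph F) hF
  refine fun h => hM (h.mono fun u v huv => hmax u v huv ?_)
  rcases huv with h' | h'
  · have : M ⊔ SimpleGraph.edge u v = M := by
      rw [sup_eq_left, SimpleGraph.edge_le_iff]; exact Or.inr (hFM h')
    rwa [this]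
  · exact not_ham_sup_edge h3 hM
      (h'.2.trans (Nat.add_le_add (dg_mono hFM u) (dg_mono hFM v)))

theorem Seg.split_mid {V : Type*} {E : SimpleGraph V} {a b x : V} {l : List V} (h : Seg E a b l)
    (hx : x ∈ l) (hxa : x ≠ a) (hxb : x ≠ b) :
    ∃ P D p d, l = P ++ ([x] ++ D) ∧ Seg E a p P ∧ E.Adj p x ∧ E.Adj x d ∧ Seg E d b D := by
  obtain ⟨P, B, p, rfl, h1, h2, h3⟩ := h.split_at hx hxa
  obtain ⟨d, D, rfl, h4, h5⟩ := h2.split_head hxb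
  exact ⟨P, D, p, d, rfl, h1, h3, h5, h4⟩

section

variable {V : Type*} {E F : SimpleGraph V} {z₁ z₂ x a : V}

theorem ham_of_crossing {A B : List V} {w w' : V} (hA : Seg E z₁ w A)
    (hB : Seg E w' z₂ B) (hs : Spanning (A ++ B)) (h1 : E.Adj w' z₁) (h2 : E.Adj w z₂) :
    HamL E :=
  ⟨_, _, _, hA.append hB.reverse h2, hs.perm ((List.reverse_perm _).symm.append_left _), h1⟩

theorem ham_of_reroute_of_mem {P D : List V} {p d : V} (hFE : F ≤ E)
    (hz : ¬ E.Adj z₁ z₂) (hx1 : E.Adj x z₁) (hx2 : E.Adj x z₂)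
    (ha1 : E.Adj a z₁) (ha2 : E.Adj a z₂)
    (R1 : ∀ s, F.Adj x s → s ≠ z₁ → s ≠ z₂ → E.Adj s z₁ ∨ E.Adj s z₂)
    (R2 : (∀ s s', F.Adj a s → F.Adj a s' → s ≠ s' → s ≠ x → s' ≠ x →
        E.Adj s s' ∨ E.Adj x s ∨ E.Adj x s') ∨
      (E.Adj x a ∧ ∀ s, F.Adj a s → s ≠ z₁ → s ≠ z₂ → E.Adj s z₁ ∨ E.Adj s z₂))
    (hP : Seg F z₁ p P) (hpx : F.Adj p x) (hxd : F.Adj x d) (hD : Seg F d z₂ D)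
    (hs : Spanning (P ++ ([x] ++ D))) (haD : a ∈ D) : HamL E := by
  classical
  by_contra hE
  have hz1D : z₁ ∉ D := fun h => by
    have := hs.1
    rw [List.nodup_append] at this
    exact this.2.2 _ hP.head_mem _ (by simp [h]) rfl
  have hPE := hP.mono hFE
  by_cases had : a = d
  · subst had
    obtain ⟨e, D', rfl, hD', hae⟩ := hD.split_head ha2.ne
    have hD'E := hD'.mono hFE
    refine hE ⟨x, z₂, ([x] ++ P.reverse) ++ ([a] ++ D'),
      ((Seg.single x).append hPE.reverse (hFE hpx).symm).append
        ((Seg.single a).append hD'E (hFE hae)) ha1.symm, hs.perm ?_, hx2.symm⟩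
    rw [List.perm_iff_count]
    intro v
    simp only [List.count_append, List.count_reverse]
    omega
  obtain ⟨M, D', m', e, rfl, hM, hma, hae, hD'⟩ := hD.split_mid haD had ha2.ne
  have hME := hM.mono hFE
  have hD'E := hD'.mono hFE
  have hnd := hs.1
  have hmD : ∀ v ∈ M, v ≠ z₂ := by
    rintro v hv rfl
    have h1 := hD'.last_mem
    simp only [List.nodup_append] at hnd
    exact hnd.2.1.2.1 |>.2.2 _ hv _ (by simp [h1]) rfl
  have hmx : ∀ v ∈ M, v ≠ x := by
    rintro v hv rfl
    simp only [List.nodup_append] at hnd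
    exact hnd.2.1.2.2 v (by simp) v (by simp [hv]) rfl
  have hex : e ≠ x := by
    rintro rfl
    have h1 := hD'.head_mem
    simp only [List.nodup_append] at hnd
    exact hnd.2.1.2.2 e (by simp) e (by simp [h1]) rfl
  have hm'e : m' ≠ e := by
    rintro rfl
    have h1 := hD'.head_mem
    simp only [List.nodup_append] at hnd
    exact hnd.2.1.2.1 |>.2.2 _ hM.last_mem _ (by simp [h1]) rfl
  by_cases hdz1 : E.Adj d z₁
  · refine hE <| ham_of_crossing (hPE.append (Seg.single x) (hFE hpx))
      (hME.append ((Seg.single a).append hD'E (hFE hae)) (hFE hma)) (by simpa using hs) hdz1 hx2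
  have hdz2 : E.Adj d z₂ := (R1 d hxd (by rintro rfl; simp [hM.head_mem] at hz1D)
    (hmD _ hM.head_mem)).resolve_left hdz1
  have key : E.Adj m' e ∨ E.Adj x m' ∨ E.Adj x e ∨ (E.Adj m' z₁ ∧ E.Adj x a) := by
    rcases R2 with h | ⟨hxa, h⟩
    · rcases h m' e hma.symm hae hm'e (hmx _ hM.last_mem) hex with h | h | h <;> simp [h]
    · by_cases hm2 : E.Adj m' z₂
      · refine absurd ?_ hE
        exact ham_of_crossing (A := P ++ ([x] ++ M)) (B := [a] ++ D') (E := E)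
          (hPE.append ((Seg.single x).append hME (hFE hxd)) (hFE hpx))
          ((Seg.single a).append hD'E (hFE hae)) (by simpa using hs) ha1 hm2
      · have := (h m' hma.symm (by rintro rfl; simp [hM.last_mem] at hz1D)
            (hmD _ hM.last_mem)).resolve_right hm2
        simp [this, hxa]
  rcases key with h | h | h | ⟨h, hxa⟩
  · refine hE ⟨z₁, a, (P ++ [x]) ++ ((M ++ D') ++ [a]), ?_, hs.perm ?_, ha1⟩
    · exact (hPE.append (Seg.single x) (hFE hpx)).append ((hME.append hD'E h).append
        (Seg.single a) ha2.symm) (hFE hxd)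
    · rw [List.perm_iff_count]
      intro v
      simp only [List.count_append]
      omega
  · refine hE ⟨a, z₁, ([a] ++ D') ++ ((M ++ [x]) ++ P.reverse), ?_, hs.perm ?_, ha1.symm⟩
    · exact ((Seg.single a).append hD'E (hFE hae)).append ((hME.append (Seg.single x) h.symm).append
        hPE.reverse (hFE hpx).symm) hdz2.symm
    · rw [List.perm_iff_count]
      intro v
      simp only [List.count_append, List.count_reverse]
      omega
  · refine hE ⟨z₁, a, ((P ++ [x]) ++ D') ++ (M ++ [a]), ?_, hs.perm ?_, ha1⟩
    · exact ((hPE.append (Seg.single x) (hFE hpx)).append hD'E h).append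
        (hME.append (Seg.single a) (hFE hma)) hdz2.symm
    · rw [List.perm_iff_count]
      intro v
      simp only [List.count_append]
      omega
  · refine hE ⟨x, a, ([x] ++ P.reverse) ++ ((M.reverse ++ D'.reverse) ++ [a]), ?_, hs.perm ?_,
      hxa.symm⟩
    · exact ((Seg.single x).append hPE.reverse (hFE hpx).symm).append
        ((hME.reverse.append hD'E.reverse hdz2).append (Seg.single a) (hFE hae).symm) h.symm
    · rw [List.perm_iff_count]
      intro v
      simp only [List.count_append, List.count_reverse]
      omega

theorem ham_of_reroute {l : List V} (hFE : F ≤ E) (hxa : x ≠ a)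
    (hz : ¬ E.Adj z₁ z₂) (hx1 : E.Adj x z₁) (hx2 : E.Adj x z₂)
    (ha1 : E.Adj a z₁) (ha2 : E.Adj a z₂)
    (R1 : ∀ s, F.Adj x s → s ≠ z₁ → s ≠ z₂ → E.Adj s z₁ ∨ E.Adj s z₂)
    (R2 : (∀ s s', F.Adj a s → F.Adj a s' → s ≠ s' → s ≠ x → s' ≠ x →
        E.Adj s s' ∨ E.Adj x s ∨ E.Adj x s') ∨
      (E.Adj x a ∧ ∀ s, F.Adj a s → s ≠ z₁ → s ≠ z₂ → E.Adj s z₁ ∨ E.Adj s z₂))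
    (hl : Seg F z₁ z₂ l) (hs : Spanning l) : HamL E := by
  obtain ⟨P, D, p, d, rfl, hP, hpx, hxd, hD⟩ := hl.split_mid (hs.2 x) hx1.ne hx2.ne
  have : a ∈ P ∨ a ∈ D := by
    have := hs.2 a
    simp only [List.mem_append, List.mem_singleton, hxa.symm, false_or] at this
    exact this
  rcases this with h | h
  · refine ham_of_reroute_of_mem hFE (fun h => hz h.symm) hx2 hx1 ha2 ha1
      (fun s h h1 h2 => (R1 s h h2 h1).symm)
      (R2.imp id fun h => ⟨h.1, fun s h0 h1 h2 => (h.2 s h0 h2 h1).symm⟩)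
      hD.reverse hxd.symm hpx.symm hP.reverse (hs.perm ?_) (List.mem_reverse.2 h)
    classical
    rw [List.perm_iff_count]
    intro v
    simp only [List.count_append, List.count_reverse]
    omega
  · exact ham_of_reroute_of_mem hFE hz hx1 hx2 ha1 ha2 R1 R2 hP hpx hxd hD hs h

end

/-- The graph obtained by making the neighbourhood of `x` complete. -/
def completeNbhd {V : Type*} (F : SimpleGraph V) (x : V) : SimpleGraph V where
  Adj u v := F.Adj u v ∨ u ≠ v ∧ F.Adj x u ∧ F.Adj x v
  symm := ⟨fun u v h => h.imp (fun h => h.symm) fun h => ⟨h.1.symm, h.2.2, h.2.1⟩⟩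
  loopless := ⟨fun u h => by rcases h with h | h; exacts [F.loopless.irrefl _ h, h.1 rfl]⟩

/-- The neighbourhood of `x` is a clique. -/
def Simplicial {V : Type*} (F : SimpleGraph V) (x : V) : Prop :=
  ∀ u v, F.Adj x u → F.Adj x v → u ≠ v → F.Adj u v

/-- Every claw has two leaves that are adjacent in `oGraph F`. -/
def ClawHeavy {V : Type*} [Fintype V] (F : SimpleGraph V) : Prop :=
  ∀ a b₁ b₂ b₃, b₁ ≠ b₂ → b₁ ≠ b₃ → b₂ ≠ b₃ → F.Adj a b₁ → F.Adj a b₂ → F.Adj a b₃ →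
    (oGraph F).Adj b₁ b₂ ∨ (oGraph F).Adj b₁ b₃ ∨ (oGraph F).Adj b₂ b₃

/-- The common closed neighbourhood of two vertices. -/
def line {V : Type*} (F : SimpleGraph V) (u v : V) : Set V :=
  {w | (w = u ∨ F.Adj u w) ∧ (w = v ∨ F.Adj v w)}

/-- `u` and `v` are connected in `G[S]`. -/
def ConnIn {V : Type*} (G : SimpleGraph V) (S : Set V) : V → V → Prop :=
  Relation.ReflTransGen fun a b => G.Adj a b ∧ a ∈ S ∧ b ∈ S

theorem ConnIn.mono {V : Type*} {G : SimpleGraph V} {S T : Set V} {u v : V} (h : ConnIn G S u v)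
    (hST : S ⊆ T) : ConnIn G T u v :=
  Relation.ReflTransGen.mono (fun _ _ h => ⟨h.1, hST h.2.1, hST h.2.2⟩) _ _ h

theorem ConnIn.symm {V : Type*} {G : SimpleGraph V} {S : Set V} {u v : V} (h : ConnIn G S u v) :
    ConnIn G S v u := by
  induction h with
  | refl => exact Relation.ReflTransGen.refl
  | tail _ h ih => exact Relation.ReflTransGen.head ⟨h.1.symm, h.2.2, h.2.1⟩ ih

/-- The ends of any `F`-edge are connected by `G`-edges inside their common closed
neighbourhood. -/
def LinesConnected {V : Type*} (G F : SimpleGraph V) : Prop :=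
  ∀ u v, F.Adj u v → ConnIn G (line F u v) u v

section

variable {V : Type*} {F F' : SimpleGraph V} {x y u v a z₁ z₂ : V}

theorem line_mono (h : F ≤ F') (u v : V) : line F u v ⊆ line F' u v :=
  fun _ hw => ⟨hw.1.imp id fun e => h e, hw.2.imp id fun e => h e⟩

theorem le_completeNbhd (F : SimpleGraph V) (x : V) : F ≤ completeNbhd F x :=
  fun _ _ h => Or.inl h

theorem completeNbhd_adj_self : (completeNbhd F x).Adj x u ↔ F.Adj x u :=
  ⟨fun h => h.elim id fun h => (F.loopless.irrefl _ h.2.1).elim, fun h => Or.inl h⟩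

theorem simplicial_of_completeNbhd_le (h : completeNbhd F x ≤ F) : Simplicial F x :=
  fun _ _ hu hv huv => h (Or.inr ⟨huv, hu, hv⟩)

theorem dg_le_completeNbhd [Finite V] (h : F.Adj x u) : dg F x ≤ dg (completeNbhd F x) u := by
  classical
  have h1 : insert x (F.neighborSet x \ {u}) ⊆ (completeNbhd F x).neighborSet u := by
    intro w hw
    rcases hw with rfl | hw
    · exact Or.inl h.symm
    · exact Or.inr ⟨fun e => hw.2 e.symm, h, hw.1⟩
  have h2 := Set.ncard_le_ncard h1 (Set.toFinite _)
  rw [Set.ncard_insert_of_notMem (by simp),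
    Set.ncard_sdiff_singleton_add_one (show u ∈ F.neighborSet x from h)] at h2
  exact h2

theorem clawHeavy_completeNbhd [Fintype V] (hF : ClawHeavy F) (x : V) :
    ClawHeavy (completeNbhd F x) := by
  have key : ∀ z b₁ b₂ b₃, b₁ ≠ b₂ → b₁ ≠ b₃ → b₂ ≠ b₃ → (completeNbhd F x).Adj z b₁ →
      (completeNbhd F x).Adj z b₂ → (completeNbhd F x).Adj z b₃ → ¬ F.Adj z b₁ →
      (oGraph (completeNbhd F x)).Adj b₁ b₂ ∨ (oGraph (completeNbhd F x)).Adj b₁ b₃ ∨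
        (oGraph (completeNbhd F x)).Adj b₂ b₃ := by
    intro z b₁ b₂ b₃ h12 h13 h23 h1 h2 h3 hn
    obtain ⟨-, hxz, hx1⟩ := h1.resolve_left hn
    by_contra hcon
    push Not at hcon
    obtain ⟨c12, c13, c23⟩ := hcon
    have hx2 : ¬ F.Adj x b₂ := fun h => c12 (Or.inl (Or.inr ⟨h12, hx1, h⟩))
    have hx3 : ¬ F.Adj x b₃ := fun h => c13 (Or.inl (Or.inr ⟨h13, hx1, h⟩))
    have hz2 : F.Adj z b₂ := h2.resolve_right fun h => hx2 h.2.2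
    have hz3 : F.Adj z b₃ := h3.resolve_right fun h => hx3 h.2.2
    have hx2' : x ≠ b₂ := by rintro rfl; exact c12 (Or.inl (Or.inl hx1.symm))
    have hx3' : x ≠ b₃ := by rintro rfl; exact c13 (Or.inl (Or.inl hx1.symm))
    have hd := dg_le_completeNbhd hx1
    rcases hF z x b₂ b₃ hx2' hx3' h23 hxz.symm hz2 hz3 with h | h | h
    · exact c12 (Or.inr ⟨h12, (h.resolve_left hx2).2.trans
        (Nat.add_le_add hd (dg_mono (le_completeNbhd F x) _))⟩)
    · exact c13 (Or.inr ⟨h13, (h.resolve_left hx3).2.trans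
        (Nat.add_le_add hd (dg_mono (le_completeNbhd F x) _))⟩)
    · exact c23 (oGraph_mono (le_completeNbhd F x) h)
  intro z b₁ b₂ b₃ h12 h13 h23 h1 h2 h3
  by_cases g1 : F.Adj z b₁
  · by_cases g2 : F.Adj z b₂
    · by_cases g3 : F.Adj z b₃
      · exact (hF z b₁ b₂ b₃ h12 h13 h23 g1 g2 g3).imp
          (fun h => oGraph_mono (le_completeNbhd F x) h)
          fun h => h.imp (fun h => oGraph_mono (le_completeNbhd F x) h)
            fun h => oGraph_mono (le_completeNbhd F x) h
      · rcases key z b₃ b₁ b₂ h13.symm h23.symm h12 h3 h1 h2 g3 with h | h | h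
        · exact Or.inr (Or.inl h.symm)
        · exact Or.inr (Or.inr h.symm)
        · exact Or.inl h
    · rcases key z b₂ b₁ b₃ h12.symm h23 h13 h2 h1 h3 g2 with h | h | h
      · exact Or.inl h.symm
      · exact Or.inr (Or.inr h)
      · exact Or.inr (Or.inl h)
  · exact key z b₁ b₂ b₃ h12 h13 h23 h1 h2 h3 g1

theorem linesConnected_completeNbhd {G : SimpleGraph V} (hF : LinesConnected G F) (x : V) :
    LinesConnected G (completeNbhd F x) := by
  intro u v huv
  rcases huv with huv | ⟨-, hu, hv⟩
  · exact (hF u v huv).mono (line_mono (le_completeNbhd F x) u v)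
  · have key : ∀ w, F.Adj x w → ConnIn G (line (completeNbhd F x) u v) x w := by
      intro w hw
      refine (hF x w hw).mono fun s hs => ?_
      rcases hs.1 with rfl | h
      · exact ⟨Or.inr (Or.inl hu.symm), Or.inr (Or.inl hv.symm)⟩
      · refine ⟨?_, ?_⟩
        · by_cases e : s = u
          exacts [Or.inl e, Or.inr (Or.inr ⟨Ne.symm e, hu, h⟩)]
        · by_cases e : s = v
          exacts [Or.inl e, Or.inr (Or.inr ⟨Ne.symm e, hv, h⟩)]
    exact (key u hu).symm.trans (key v hv)

theorem linesConnected_refl (G : SimpleGraph V) : LinesConnected G G := fun _ _ h =>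
  Relation.ReflTransGen.single ⟨h, ⟨Or.inl rfl, Or.inr h.symm⟩, ⟨Or.inr h, Or.inl rfl⟩⟩

variable [Fintype V]

/-- Two vertices at distance two in a neighbourhood may be joined. -/
theorem not_ham_join_of_nbhd (h3 : 3 ≤ Fintype.card V) (hC : ClawHeavy F) (h1 : F ≤ F')
    (h2 : F' ≤ completeNbhd F x) (hn : ¬ HamL F') (ha : F.Adj x a) (hx1 : F.Adj x z₁)
    (hx2 : F.Adj x z₂) (ha1 : F'.Adj a z₁) (ha2 : F'.Adj a z₂) (hz : z₁ ≠ z₂) :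
    ¬ HamL (F' ⊔ SimpleGraph.edge z₁ z₂) := by
  by_cases ho : (oGraph F').Adj z₁ z₂
  · rcases ho with h | h
    · have : F' ⊔ SimpleGraph.edge z₁ z₂ = F' := by
        rw [sup_eq_left, SimpleGraph.edge_le_iff]; exact Or.inr h
      rwa [this]
    · exact not_ham_sup_edge h3 hn h.2
  intro hh
  obtain ⟨l, hl, hs⟩ := ham_path_of_ham_edge h3 hh hn
  refine not_ham_oGraph h3 hn (ham_of_reroute (le_oGraph F') ha.ne ho (Or.inl (h1 hx1))
    (Or.inl (h1 hx2)) (Or.inl ha1) (Or.inl ha2) ?_ (Or.inl ?_) hl hs)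
  · intro s hxs hs1 hs2
    have := hC x s z₁ z₂ hs1 hs2 hz (completeNbhd_adj_self.1 (h2 hxs)) hx1 hx2
    rcases this with h | h | h
    · exact Or.inl (oGraph_mono h1 h)
    · exact Or.inr (oGraph_mono h1 h)
    · exact absurd (oGraph_mono h1 h) ho
  · intro s s' has has' hss hsx hsx'
    by_cases g1 : F.Adj x s
    · exact Or.inr (Or.inl (Or.inl (h1 g1)))
    by_cases g2 : F.Adj x s'
    · exact Or.inr (Or.inr (Or.inl (h1 g2)))
    have k1 : F.Adj a s := (h2 has).resolve_right fun h => g1 h.2.2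
    have k2 : F.Adj a s' := (h2 has').resolve_right fun h => g2 h.2.2
    rcases hC a x s s' hsx.symm hsx'.symm hss ha.symm k1 k2 with h | h | h
    · exact Or.inr (Or.inl (oGraph_mono h1 h))
    · exact Or.inr (Or.inr (oGraph_mono h1 h))
    · exact Or.inl (oGraph_mono h1 h)

/-- Two common neighbours of a heavy pair may be joined. -/
theorem not_ham_join_of_heavy (h3 : 3 ≤ Fintype.card V) (hC : ClawHeavy F) (hn : ¬ HamL F)
    (hxy : (oGraph F).Adj x y) (hx1 : F.Adj x z₁) (hx2 : F.Adj x z₂) (hy1 : F.Adj y z₁)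
    (hy2 : F.Adj y z₂) (hz : z₁ ≠ z₂) (ho : ¬ (oGraph F).Adj z₁ z₂) :
    ¬ HamL (F ⊔ SimpleGraph.edge z₁ z₂) := by
  intro hh
  obtain ⟨l, hl, hs⟩ := ham_path_of_ham_edge h3 hh hn
  have key : ∀ w, F.Adj w z₁ → F.Adj w z₂ → ∀ s, F.Adj w s → s ≠ z₁ → s ≠ z₂ →
      (oGraph F).Adj s z₁ ∨ (oGraph F).Adj s z₂ := by
    intro w hw1 hw2 s hws hs1 hs2
    rcases hC w s z₁ z₂ hs1 hs2 hz hws hw1 hw2 with h | h | h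
    exacts [Or.inl h, Or.inr h, absurd h ho]
  exact not_ham_oGraph h3 hn (ham_of_reroute (le_oGraph F) hxy.ne ho (Or.inl hx1)
    (Or.inl hx2) (Or.inl hy1) (Or.inl hy2) (key x hx1 hx2) (Or.inr ⟨hxy, key y hy1 hy2⟩) hl hs)

end

/-- The properties of a closure of `G` that are preserved by completing neighbourhoods. -/
structure Good {V : Type*} [Fintype V] (G F : SimpleGraph V) : Prop where
  le : G ≤ F
  not_ham : ¬ HamL F
  claw : ClawHeavy F
  lines : LinesConnected G F

section

variable {V : Type*} [Fintype V] {G F F₀ : SimpleGraph V} {x y z u v a z₁ z₂ : V}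

theorem exists_completion (h3 : 3 ≤ Fintype.card V) (hM : Maximal (Good G) F) (h0 : F ≤ F₀)
    (h0' : F₀ ≤ completeNbhd F x) (hn : ¬ HamL F₀) : ∃ F₁, F₀ ≤ F₁ ∧
      (∀ u v, F.Adj x u → F.Adj x v → (oGraph F₁).Adj u v → F₁.Adj u v) ∧
      (∀ a u v, F.Adj x a → F.Adj x u → F.Adj x v → F₁.Adj a u → F₁.Adj a v → u ≠ v →
        F₁.Adj u v) ∧
      ((∀ u v, F.Adj x u → F.Adj x v → u ≠ v → F₁.Adj u v) → Simplicial F x) := by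
  obtain ⟨F₁, h01, h1, hn1, hmax⟩ := exists_maximal_not_ham h0' hn
  refine ⟨F₁, h01, fun u v hu hv huv => ?_, fun a u v ha hu hv hau hav huv => ?_, fun h => ?_⟩
  · rcases huv with huv | huv
    · exact huv
    · exact hmax _ _ (Or.inr ⟨huv.1, hu, hv⟩) (not_ham_sup_edge h3 hn1 huv.2)
  · exact hmax _ _ (Or.inr ⟨huv, hu, hv⟩)
      (not_ham_join_of_nbhd h3 hM.prop.claw (h0.trans h01) h1 hn1 ha hu hv hau hav huv)
  · apply simplicial_of_completeNbhd_le
    refine hM.le_of_ge ⟨hM.prop.le.trans (le_completeNbhd F x), fun hh => hn1 (hh.mono ?_),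
      clawHeavy_completeNbhd hM.prop.claw x, linesConnected_completeNbhd hM.prop.lines x⟩
      (le_completeNbhd F x)
    intro u v huv
    rcases huv with huv | ⟨huv, hu, hv⟩
    exacts [h01 (h0 huv), h u v hu hv huv]

theorem simplicial_of_dominating (h3 : 3 ≤ Fintype.card V) (hM : Maximal (Good G) F)
    (hz : F.Adj x z) (h : ∀ s, F.Adj x s → s ≠ z → (oGraph F).Adj z s) : Simplicial F x := by
  obtain ⟨F₁, h01, hH, hT, hS⟩ := exists_completion h3 hM le_rfl (le_completeNbhd F x)
    hM.prop.not_ham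
  have key : ∀ s, F.Adj x s → s ≠ z → F₁.Adj z s := fun s hs hsz =>
    hH _ _ hz hs (oGraph_mono h01 (h s hs hsz))
  refine hS fun u v hu hv huv => ?_
  by_cases huz : u = z
  · subst huz; exact key v hv huv.symm
  by_cases hvz : v = z
  · subst hvz; exact (key u hu huv).symm
  exact hT z u v hz hu hv (key u hu huz) (key v hv hvz) huv

theorem oGraph_trans_of_maximal (h3 : 3 ≤ Fintype.card V) (hM : Maximal (Good G) F)
    (ha : F.Adj x a) (h1 : F.Adj x z₁) (h2 : F.Adj x z₂) (ha1 : (oGraph F).Adj a z₁)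
    (ha2 : (oGraph F).Adj a z₂) (hz : z₁ ≠ z₂) : (oGraph F).Adj z₁ z₂ := by
  by_contra ho
  obtain ⟨F₁, h01, hH, hT, hS⟩ := exists_completion h3 hM le_rfl (le_completeNbhd F x)
    hM.prop.not_ham
  have e1 : F₁.Adj a z₁ := hH _ _ ha h1 (oGraph_mono h01 ha1)
  have e2 : F₁.Adj a z₂ := hH _ _ ha h2 (oGraph_mono h01 ha2)
  have key : ∀ s, F.Adj x s → s ≠ a → F₁.Adj a s := by
    intro s hs hsa
    by_cases hs1 : s = z₁
    · rwa [hs1]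
    by_cases hs2 : s = z₂
    · rwa [hs2]
    rcases hM.prop.claw x s z₁ z₂ hs1 hs2 hz hs h1 h2 with h | h | h
    · exact hT z₁ a s h1 ha hs e1.symm (hH _ _ hs h1 (oGraph_mono h01 h)).symm (Ne.symm hsa)
    · exact hT z₂ a s h2 ha hs e2.symm (hH _ _ hs h2 (oGraph_mono h01 h)).symm (Ne.symm hsa)
    · exact absurd h ho
  refine ho (Or.inl (hS (fun u v hu hv huv => ?_) _ _ h1 h2 hz))
  by_cases hua : u = a
  · subst hua; exact key v hv huv.symm
  by_cases hva : v = a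
  · subst hva; exact (key u hu huv).symm
  exact hT a u v ha hu hv (key u hu hua) (key v hv hva) huv

theorem oGraph_of_common_of_heavy (h3 : 3 ≤ Fintype.card V) (hM : Maximal (Good G) F)
    (hxy : (oGraph F).Adj x y) (h1 : F.Adj x z₁) (h2 : F.Adj x z₂)
    (hy1 : F.Adj y z₁) (hy2 : F.Adj y z₂) (hz : z₁ ≠ z₂) : (oGraph F).Adj z₁ z₂ := by
  by_contra ho
  have hn := not_ham_join_of_heavy h3 hM.prop.claw hM.prop.not_ham hxy h1 h2 hy1 hy2 hz ho
  obtain ⟨F₁, h01, hH, hT, hS⟩ := exists_completion (x := x) h3 hM le_sup_left (sup_le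
    (le_completeNbhd F x) (by rw [SimpleGraph.edge_le_iff]; exact Or.inr (Or.inr ⟨hz, h1, h2⟩))) hn
  have h01' : F ≤ F₁ := le_sup_left.trans h01
  have e : F₁.Adj z₁ z₂ := h01 (Or.inr (by simp [SimpleGraph.edge_adj, hz]))
  have key : ∀ s, F.Adj x s → s ≠ z₁ → F₁.Adj z₁ s := by
    intro s hs hs1
    by_cases hs2 : s = z₂
    · rwa [hs2]
    rcases hM.prop.claw x s z₁ z₂ hs1 hs2 hz hs h1 h2 with h | h | h
    · exact (hH _ _ hs h1 (oGraph_mono h01' h)).symm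
    · exact hT z₂ z₁ s h2 h1 hs e.symm (hH _ _ hs h2 (oGraph_mono h01' h)).symm (Ne.symm hs1)
    · exact absurd h ho
  refine ho (Or.inl (hS (fun u v hu hv huv => ?_) _ _ h1 h2 hz))
  by_cases hua : u = z₁
  · subst hua; exact key v hv huv.symm
  by_cases hva : v = z₁
  · subst hva; exact (key u hu huv).symm
  exact hT z₁ u v h1 hu hv (key u hu hua) (key v hv hva) huv

/-- The number of common neighbours of a heavy nonadjacent pair. -/
theorem card_common_of_heavy (hxy : x ≠ y) (hn : ¬ F.Adj x y)
    (hd : Fintype.card V ≤ dg F x + dg F y) :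
    {w | w ≠ x ∧ w ≠ y ∧ ¬ F.Adj x w ∧ ¬ F.Adj y w}.ncard + 2 ≤
      {w | F.Adj x w ∧ F.Adj y w}.ncard := by
  have h1 := Set.ncard_union_add_ncard_inter (F.neighborSet x) (F.neighborSet y)
  have h2 : ({x, y} ∪ {w | w ≠ x ∧ w ≠ y ∧ ¬ F.Adj x w ∧ ¬ F.Adj y w}) ∪
      (F.neighborSet x ∪ F.neighborSet y) = Set.univ := by
    ext w
    simp only [Set.mem_union, Set.mem_insert_iff, Set.mem_singleton_iff, Set.mem_ofPred_eq,
      SimpleGraph.mem_neighborSet, Set.mem_univ, iff_true]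
    tauto
  have h3 : Disjoint (({x, y} : Set V) ∪ {w | w ≠ x ∧ w ≠ y ∧ ¬ F.Adj x w ∧ ¬ F.Adj y w})
      (F.neighborSet x ∪ F.neighborSet y) := by
    rw [Set.disjoint_left]
    rintro w (hw | hw) hw'
    · rcases hw with rfl | hw
      · rcases hw' with h | h
        exacts [F.loopless.irrefl _ h, hn h.symm]
      · rw [Set.mem_singleton_iff] at hw
        subst hw
        rcases hw' with h | h
        exacts [hn h, F.loopless.irrefl _ h]
    · exact hw'.elim hw.2.2.1 hw.2.2.2
  have h4 : Disjoint ({x, y} : Set V) {w | w ≠ x ∧ w ≠ y ∧ ¬ F.Adj x w ∧ ¬ F.Adj y w} := by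
    rw [Set.disjoint_left]
    rintro w (hw | hw) hw'
    exacts [hw'.1 hw, hw'.2.1 hw]
  have h5 := Set.ncard_union_eq h3 (Set.toFinite _) (Set.toFinite _)
  rw [h2, Set.ncard_univ, Nat.card_eq_fintype_card,
    Set.ncard_union_eq h4 (Set.toFinite _) (Set.toFinite _), Set.ncard_pair hxy] at h5
  have h6 : {w | F.Adj x w ∧ F.Adj y w} = F.neighborSet x ∩ F.neighborSet y := rfl
  rw [h6]
  unfold dg at hd
  omega

theorem adj_of_oGraph_of_maximal (h3 : 3 ≤ Fintype.card V) (hM : Maximal (Good G) F)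
    (h : (oGraph F).Adj x y) : F.Adj x y := by
  by_contra hn
  have hd := (h.resolve_left hn).2
  have hc := card_common_of_heavy h.ne hn hd
  have key : ∀ w, F.Adj x w ∧ F.Adj y w → ∃ t, F.Adj w t ∧ t ≠ x ∧ ¬ (oGraph F).Adj x t ∧
      t ≠ y ∧ ¬ (oGraph F).Adj y t := by
    rintro w ⟨h1, h2⟩
    by_contra hcon
    refine hn (simplicial_of_dominating h3 hM h1.symm (fun s hs hsx => ?_) _ _ h1.symm h2.symm h.ne)
    by_contra ho
    refine hcon ⟨s, hs, hsx, ho, ?_, fun hy => ho ?_⟩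
    · rintro rfl
      exact ho h
    · exact oGraph_trans_of_maximal h3 hM h2.symm h1.symm hs h.symm hy (Ne.symm hsx)
  choose! t ht using key
  have hmaps : ∀ w ∈ {w | F.Adj x w ∧ F.Adj y w},
      t w ∈ {w | w ≠ x ∧ w ≠ y ∧ ¬ F.Adj x w ∧ ¬ F.Adj y w} := fun w hw =>
    ⟨(ht w hw).2.1, (ht w hw).2.2.2.1, fun h => (ht w hw).2.2.1 (Or.inl h),
      fun h => (ht w hw).2.2.2.2 (Or.inl h)⟩
  obtain ⟨w, hw, w', hw', hne, htt⟩ := Set.exists_ne_map_eq_of_ncard_lt_of_maps_to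
    (by omega) hmaps (Set.toFinite _)
  obtain ⟨hwt, htx, htx', -, -⟩ := ht w hw
  have hwt' : F.Adj w' (t w) := htt ▸ (ht w' hw').1
  by_cases ho : (oGraph F).Adj w w'
  · exact htx' (oGraph_of_common_of_heavy h3 hM ho hw.1.symm hwt hw'.1.symm hwt' (Ne.symm htx))
  · exact ho (oGraph_of_common_of_heavy h3 hM h hw.1 hw'.1 hw.2 hw'.2 hne)

/-- The outcome of the closure: a nonhamiltonian claw-free and diamond-free supergraph. -/
structure Closed {V : Type*} [Fintype V] (G F : SimpleGraph V) : Prop where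
  le : G ≤ F
  not_ham : ¬ HamL F
  lines : LinesConnected G F
  heavy : ∀ x y, x ≠ y → Fintype.card V ≤ dg F x + dg F y → F.Adj x y
  claw : ∀ a b₁ b₂ b₃, b₁ ≠ b₂ → b₁ ≠ b₃ → b₂ ≠ b₃ → F.Adj a b₁ → F.Adj a b₂ → F.Adj a b₃ →
    F.Adj b₁ b₂ ∨ F.Adj b₁ b₃ ∨ F.Adj b₂ b₃
  diamond : ∀ x a z₁ z₂, F.Adj x a → F.Adj x z₁ → F.Adj x z₂ → F.Adj a z₁ → F.Adj a z₂ →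
    z₁ ≠ z₂ → F.Adj z₁ z₂

theorem exists_closed (h3 : 3 ≤ Fintype.card V) (hG : ClawHeavy G) (hn : ¬ HamL G) :
    ∃ F, Closed G F := by
  obtain ⟨F, -, hM⟩ := Set.Finite.exists_le_maximal (s := {F : SimpleGraph V | Good G F})
    (Set.toFinite _) (⟨le_rfl, hn, hG, linesConnected_refl G⟩ : Good G G)
  have hM' : Maximal (Good G) F := hM
  have ho := fun {x y} => adj_of_oGraph_of_maximal (x := x) (y := y) h3 hM'
  refine ⟨F, hM'.prop.le, hM'.prop.not_ham, hM'.prop.lines, fun x y hxy h => ho (Or.inr ⟨hxy, h⟩),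
    fun a b₁ b₂ b₃ h12 h13 h23 h1 h2 h3 => ?_, fun x a z₁ z₂ h1 h2 h3' h4 h5 h6 => ?_⟩
  · exact (hM'.prop.claw a b₁ b₂ b₃ h12 h13 h23 h1 h2 h3).imp ho fun h => h.imp ho ho
  · exact ho (oGraph_trans_of_maximal h3 hM' h1 h2 h3' (Or.inl h4) (Or.inl h5) h6)

end

/-- The subgraph of `G` induced by `S`, on the same vertex type. -/
def inside {V : Type*} (G : SimpleGraph V) (S : Set V) : SimpleGraph V where
  Adj a b := G.Adj a b ∧ a ∈ S ∧ b ∈ S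
  symm := ⟨fun _ _ h => ⟨h.1.symm, h.2.2, h.2.1⟩⟩
  loopless := ⟨fun _ h => G.loopless.irrefl _ h.1⟩

theorem ConnIn.reachable {V : Type*} {G : SimpleGraph V} {S : Set V} {u v : V}
    (h : ConnIn G S u v) : (inside G S).Reachable u v := by
  induction h with
  | refl => exact SimpleGraph.Reachable.refl _
  | tail _ h ih => exact ih.trans (SimpleGraph.Adj.reachable h)

theorem ConnIn.diff_singleton {V : Type*} {G : SimpleGraph V} {S : Set V} {u v z : V}
    (h : ConnIn G S u v) (hu : u ≠ z) (hv : v ≠ z)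
    (hz : ∀ s s', s ∈ S → s' ∈ S → G.Adj z s → G.Adj z s' → s ≠ s' →
      ConnIn G (S \ {z}) s s') : ConnIn G (S \ {z}) u v := by
  have key : (v ≠ z → ConnIn G (S \ {z}) u v) ∧
      (v = z → ∃ s ∈ S, G.Adj z s ∧ ConnIn G (S \ {z}) u s) := by
    clear hv
    induction h with
    | refl => exact ⟨fun _ => Relation.ReflTransGen.refl, fun h => absurd h hu⟩
    | @tail b c hb hbc ih =>
      refine ⟨fun hc => ?_, ?_⟩
      · by_cases hbz : b = z
        · obtain ⟨s, hs, hzs, hus⟩ := ih.2 hbz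
          subst hbz
          by_cases hsc : s = c
          · rwa [← hsc]
          · exact hus.trans (hz s c hs hbc.2.2 hzs hbc.1 hsc)
        · exact (ih.1 hbz).tail ⟨hbc.1, ⟨hbc.2.1, hbz⟩, ⟨hbc.2.2, hc⟩⟩
      · rintro rfl
        exact ⟨b, hbc.2.1, hbc.1.symm, ih.1 hbc.1.ne⟩
  exact key.1 hv

section

variable {V : Type*} [Fintype V] {G F : SimpleGraph V} {x y z : V}

theorem Closed.adj_of_oGraph (hF : Closed G F) (h : (oGraph G).Adj x y) : F.Adj x y :=
  h.elim (fun h => hF.le h) fun h =>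
    hF.heavy x y h.1 (h.2.trans (Nat.add_le_add (dg_mono hF.le x) (dg_mono hF.le y)))

/-- A nonsimplicial vertex has a `G`-neighbour outside any given line through it. -/
theorem Closed.exists_adj_off_line (hF : Closed G F) (hz : ¬ Simplicial F z) (hx : F.Adj z x) :
    ∃ t, G.Adj z t ∧ t ≠ x ∧ ¬ F.Adj x t := by
  have : ∃ r, F.Adj z r ∧ r ≠ x ∧ ¬ F.Adj x r := by
    by_contra hcon
    push Not at hcon
    refine hz fun u v hu hv huv => ?_
    by_cases hux : u = x
    · subst hux; exact hcon v hv huv.symm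
    by_cases hvx : v = x
    · subst hvx; exact (hcon u hu huv).symm
    exact hF.diamond z x u v hx hu hv (hcon u hu hux) (hcon v hv hvx) huv
  obtain ⟨r, hr, hrx, hxr⟩ := this
  rcases (hF.lines z r hr).cases_head with h | ⟨t, ⟨hzt, -, ht⟩, -⟩
  · exact absurd h hr.ne
  refine ⟨t, hzt, ?_, fun hxt => ?_⟩
  · rintro rfl
    rcases ht.2 with h | h
    exacts [hrx h.symm, hxr h.symm]
  · rcases ht.2 with rfl | hrt
    · exact hxr hxt
    · exact hxr (hF.diamond z t x r (hF.le hzt) hx hr hxt.symm hrt.symm hrx.symm)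

theorem Closed.exists_simplicial_common (hF : Closed G F) (hxy : x ≠ y) (hn : ¬ G.Adj x y)
    (hd : Fintype.card V ≤ dg G x + dg G y) : ∃ w, G.Adj x w ∧ G.Adj y w ∧ Simplicial F w := by
  by_contra hcon
  have hFxy : F.Adj x y := hF.adj_of_oGraph (Or.inr ⟨hxy, hd⟩)
  have hc := card_common_of_heavy hxy hn hd
  have key : ∀ w, G.Adj x w ∧ G.Adj y w → ∃ t, G.Adj w t ∧ t ≠ x ∧ ¬ F.Adj x t := fun w hw =>
    hF.exists_adj_off_line (fun h => hcon ⟨w, hw.1, hw.2, h⟩) (hF.le hw.1.symm)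
  choose! t ht using key
  have hmaps : ∀ w ∈ {w | G.Adj x w ∧ G.Adj y w},
      t w ∈ {w | w ≠ x ∧ w ≠ y ∧ ¬ G.Adj x w ∧ ¬ G.Adj y w} := fun w hw => by
    obtain ⟨h1, h2, h3⟩ := ht w hw
    have hty : t w ≠ y := fun h => h3 (h ▸ hFxy)
    exact ⟨h2, hty, fun h => h3 (hF.le h), fun h => h3 (hF.diamond w y x (t w)
      (hF.le hw.2.symm) (hF.le hw.1.symm) (hF.le h1) hFxy.symm (hF.le h) h2.symm)⟩
  obtain ⟨w, hw, w', hw', hne, htt⟩ := Set.exists_ne_map_eq_of_ncard_lt_of_maps_to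
    (by omega) hmaps (Set.toFinite _)
  obtain ⟨h1, h2, h3⟩ := ht w hw
  have h1' : G.Adj w' (t w) := htt ▸ (ht w' hw').1
  have hww : F.Adj w w' := hF.diamond x y w w' hFxy (hF.le hw.1) (hF.le hw'.1) (hF.le hw.2)
    (hF.le hw'.2) hne
  exact h3 (hF.diamond w w' x (t w) hww (hF.le hw.1.symm) (hF.le h1) (hF.le hw'.1.symm)
    (hF.le h1') h2.symm)

theorem Closed.connIn_line_diff (hF : Closed G F) (hG : ClawHeavy G) {D : Set V}
    (hD : ∀ v ∈ D, ¬ Simplicial F v) (hxy : F.Adj x y) (hx : x ∉ D) (hy : y ∉ D) :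
    ConnIn G (line F x y \ D) x y := by
  induction D, Set.toFinite D using Set.Finite.induction_on with
  | empty => simpa using hF.lines x y hxy
  | @insert z D hzD _ ih =>
    have ih := ih (fun v hv => hD v (Or.inr hv)) (fun h => hx (Or.inr h)) fun h => hy (Or.inr h)
    have hxz : x ≠ z := by rintro rfl; exact hx (Or.inl rfl)
    have hyz : y ≠ z := by rintro rfl; exact hy (Or.inl rfl)
    have e : line F x y \ insert z D = (line F x y \ D) \ {z} := by
      ext w
      simp only [Set.mem_sdiff, Set.mem_insert_iff, Set.mem_singleton_iff]
      tauto
    rw [e]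
    by_cases hzL : z ∈ line F x y
    swap
    · refine ih.mono fun w hw => ⟨hw, ?_⟩
      rintro rfl
      exact hzL hw.1
    have hzx : F.Adj z x := (hzL.1.resolve_left hxz.symm).symm
    refine ih.diff_singleton hxz hyz fun s s' hs hs' hzs hzs' hss => ?_
    by_cases hGs : G.Adj s s'
    · exact Relation.ReflTransGen.single ⟨hGs, ⟨hs, hzs.ne'⟩, ⟨hs', hzs'.ne'⟩⟩
    obtain ⟨t, hzt, htx, hxt⟩ := hF.exists_adj_off_line (hD z (Or.inl rfl)) hzx
    have hst : ∀ s ∈ line F x y, G.Adj z s → s ≠ t ∧ ¬ (oGraph G).Adj s t := by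
      intro s hs hzs
      refine ⟨?_, fun ho => ?_⟩
      · rintro rfl
        exact hs.1.elim htx hxt
      · have ho := hF.adj_of_oGraph ho
        rcases hs.1 with rfl | hxs
        · exact hxt ho
        · exact hxt (hF.diamond z s x t (hF.le hzs) hzx (hF.le hzt) hxs.symm ho htx.symm)
    rcases hG z s s' t hss (hst s hs.1 hzs).1 (hst s' hs'.1 hzs').1 hzs hzs' hzt with h | h | h
    · obtain ⟨w, hsw, hsw', hw⟩ := hF.exists_simplicial_common hss hGs (h.resolve_left hGs).2
      have hwz : w ≠ z := by rintro rfl; exact hD w (Or.inl rfl) hw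
      have hwD : w ∉ D := fun hw' => hD w (Or.inr hw') hw
      have hFss := hF.adj_of_oGraph h
      have key : ∀ p, (s = p ∨ F.Adj p s) → (s' = p ∨ F.Adj p s') → w = p ∨ F.Adj p w := by
        intro p h1 h2
        rcases h1 with rfl | h1
        · exact Or.inr (hF.le hsw)
        rcases h2 with rfl | h2
        · exact Or.inr (hF.le hsw')
        by_cases hwp : w = p
        · exact Or.inl hwp
        · exact Or.inr (hF.diamond s s' p w hFss h1.symm (hF.le hsw) h2.symm (hF.le hsw')
            (Ne.symm hwp))
      have hwL : w ∈ (line F x y \ D) \ {z} :=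
        ⟨⟨⟨key x hs.1.1 hs'.1.1, key y hs.1.2 hs'.1.2⟩, hwD⟩, hwz⟩
      exact (Relation.ReflTransGen.single ⟨hsw, ⟨hs, hzs.ne'⟩, hwL⟩).tail
        ⟨hsw'.symm, hwL, ⟨hs', hzs'.ne'⟩⟩
    · exact absurd h (hst s hs.1 hzs).2
    · exact absurd h (hst s' hs'.1 hzs').2

theorem Closed.connIn_of_connIn (hF : Closed G F) (hG : ClawHeavy G) {D : Set V}
    (hD : ∀ v ∈ D, ¬ Simplicial F v) (h : ConnIn F Dᶜ x y) : ConnIn G Dᶜ x y := by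
  induction h with
  | refl => exact Relation.ReflTransGen.refl
  | tail _ h ih =>
    exact ih.trans ((hF.connIn_line_diff hG hD h.1 h.2.1 h.2.2).mono fun w hw => hw.2)

end

theorem degree_eq_dg {V : Type*} [Fintype V] (G : SimpleGraph V) [DecidableRel G.Adj] (v : V) :
    G.degree v = dg G v := by
  rw [dg, Set.ncard_eq_toFinset_card', ← SimpleGraph.card_neighborFinset_eq_degree]
  rfl

/-- Heaviness with respect to `γ₂`, for induced paths indexed by natural numbers. -/
theorem P6GammaHeavy.exists_pair {V : Type*} [Fintype V] {G : SimpleGraph V} [DecidableRel G.Adj]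
    (hP : P6GammaHeavy G gamma2) {v : ℕ → V}
    (hinj : ∀ i j, i < j → j ≤ 5 → v i ≠ v j)
    (hadj : ∀ i j, i < j → j ≤ 5 → (G.Adj (v i) (v j) ↔ i + 1 = j))
    (hfar : ∀ i j, i + 3 ≤ j → j ≤ 5 → dg G (v i) + dg G (v j) < Fintype.card V) :
    (Fintype.card V ≤ 2 * dg G (v 0) ∨ Fintype.card V ≤ dg G (v 0) + dg G (v 1)) ∨
      (Fintype.card V ≤ 2 * dg G (v 5) ∨ Fintype.card V ≤ dg G (v 5) + dg G (v 4)) := by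
  have hind : IsInducedP6 G fun i => v i.val := by
    refine ⟨fun i j hij => ?_, fun i j => ?_⟩
    · rcases lt_trichotomy i.val j.val with h | h | h
      · exact absurd hij (hinj _ _ h (by omega))
      · exact Fin.ext h
      · exact absurd hij.symm (hinj _ _ h (by omega))
    · rcases lt_trichotomy i.val j.val with h | h | h
      · rw [hadj _ _ h (by omega)]; omega
      · obtain rfl := Fin.ext h
        simp
      · rw [G.adj_comm, hadj _ _ h (by omega)]; omega
  obtain ⟨i, j, hij, hd⟩ := hP _ hind
  rw [degree_eq_dg, degree_eq_dg] at hd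
  have h03 := hfar 0 3 (by omega) (by omega)
  have h04 := hfar 0 4 (by omega) (by omega)
  have h05 := hfar 0 5 (by omega) (by omega)
  have h14 := hfar 1 4 (by omega) (by omega)
  have h15 := hfar 1 5 (by omega) (by omega)
  have h25 := hfar 2 5 (by omega) (by omega)
  simp only [gamma2, Set.mem_insert_iff, Set.mem_singleton_iff, Sym2.eq_iff] at hij
  rcases hij with h | h | h | h | h | h | h | h | h | h <;>
    rcases h with ⟨rfl, rfl⟩ | ⟨rfl, rfl⟩ <;>
    simp only [Fin.coe_ofNat_eq_mod] at hd <;>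
    norm_num at hd <;> omega

section

variable {V : Type*} [Fintype V] {G F : SimpleGraph V}

theorem heavy_end_of_long_path [DecidableRel G.Adj] (hP : P6GammaHeavy G gamma2) {v : ℕ → V} {L : ℕ}
    (hinj : ∀ i j, i < j → j ≤ L → v i ≠ v j)
    (hadj : ∀ i j, i < j → j ≤ L → (G.Adj (v i) (v j) ↔ i + 1 = j))
    (hfar : ∀ i j, i + 3 ≤ j → j ≤ L → dg G (v i) + dg G (v j) < Fintype.card V) (k : ℕ) :
    ∀ i, i + (k + 5) ≤ L →
    (Fintype.card V ≤ 2 * dg G (v i) ∨ Fintype.card V ≤ dg G (v i) + dg G (v (i + 1))) ∨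
      (Fintype.card V ≤ 2 * dg G (v (i + (k + 5))) ∨
        Fintype.card V ≤ dg G (v (i + (k + 5))) + dg G (v (i + (k + 4)))) := by
  induction k with
  | zero =>
    intro i hi
    have := hP.exists_pair (v := fun t => v (i + t))
      (fun a b h h' => hinj _ _ (by omega) (by omega))
      (fun a b h h' => by rw [hadj _ _ (by omega) (by omega)]; omega)
      (fun a b h h' => hfar _ _ (by omega) (by omega))
    simpa using this
  | succ k ih =>
    intro i hi
    have h1 := ih i (by omega)
    have h2 := ih (i + 1) (by omega)
    have f1 := hfar (i + 1) (i + (k + 5)) (by omega) (by omega)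
    have f2 := hfar (i + 1) (i + (k + 4)) (by omega) (by omega)
    have f3 := hfar (i + 1 + 1) (i + (k + 5)) (by omega) (by omega)
    have e1 : i + 1 + (k + 5) = i + (k + 1 + 5) := by ring
    have e2 : i + 1 + (k + 4) = i + (k + 1 + 4) := by ring
    rw [e1, e2] at h2
    omega

/-- Among vertices outside `D`, those that are `F`-connected outside `D` and far from a vertex `m`
of maximum degree are joined by a short walk outside `D`. -/
theorem Closed.exists_short_walk [DecidableRel G.Adj] (hF : Closed G F) (hG : ClawHeavy G)
    (hP : P6GammaHeavy G gamma2) {m : V} (hm : ∀ v, dg G v ≤ dg G m) {D : Set V}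
    (hD : ∀ v ∈ D, ¬ Simplicial F v) {x y : V} (h : ConnIn F Dᶜ x y)
    (hx : ¬ (x = m ∨ F.Adj m x)) (hy : ¬ (y = m ∨ F.Adj m y)) :
    ∃ p : (inside G Dᶜ).Walk x y, p.length ≤ 4 := by
  have hr := (hF.connIn_of_connIn hG hD h).reachable
  obtain ⟨p, hp⟩ := hr.exists_walk_length_eq_dist
  refine ⟨p, ?_⟩
  by_contra hlen
  push Not at hlen
  have hreach : ∀ i, (inside G Dᶜ).Reachable x (p.getVert i) := fun i => (p.take i).reachable
  have hle : ∀ i k, i + k ≤ p.length →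
      (inside G Dᶜ).dist (p.getVert i) (p.getVert (i + k)) ≤ k := by
    intro i k
    induction k with
    | zero => intro _; simp
    | succ k ih =>
      intro hk
      have h1 := ih (by omega)
      have h2 : (inside G Dᶜ).dist (p.getVert (i + k)) (p.getVert (i + k + 1)) = 1 :=
        SimpleGraph.dist_eq_one_iff_adj.2 (p.adj_getVert_succ (by omega))
      have h3 := ((hreach i).symm.trans (hreach (i + k))).dist_triangle_left
        (p.getVert (i + (k + 1)))
      rw [← add_assoc] at h3 ⊢
      omega
  have hdist : ∀ i j, i ≤ j → j ≤ p.length →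
      j ≤ i + (inside G Dᶜ).dist (p.getVert i) (p.getVert j) := by
    intro i j hij hj
    have h1 := hle 0 i (by omega)
    have h2 := hle j (p.length - j) (by omega)
    have h3 := (hreach i).dist_triangle_left y
    have h4 := ((hreach i).symm.trans (hreach j)).dist_triangle_left y
    rw [show j + (p.length - j) = p.length by omega, p.getVert_length] at h2
    simp only [zero_add, p.getVert_zero] at h1
    omega
  have hout : ∀ i ≤ p.length, p.getVert i ∈ Dᶜ := by
    intro i hi
    by_cases h : i < p.length
    · exact (p.adj_getVert_succ h).2.1
    · have := p.adj_getVert_succ (i := i - 1) (by omega)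
      rw [show i - 1 + 1 = i by omega] at this
      exact this.2.2
  have hinj : ∀ i j, i < j → j ≤ p.length → p.getVert i ≠ p.getVert j := by
    intro i j hij hj h
    have := hdist i j hij.le hj
    rw [h, SimpleGraph.dist_self] at this
    omega
  have hadj : ∀ i j, i < j → j ≤ p.length → (G.Adj (p.getVert i) (p.getVert j) ↔ i + 1 = j) := by
    intro i j hij hj
    constructor
    · intro h
      have h1 := hdist i j hij.le hj
      rw [SimpleGraph.dist_eq_one_iff_adj.2
        (show (inside G Dᶜ).Adj _ _ from ⟨h, hout i (by omega), hout j hj⟩)] at h1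
      omega
    · rintro rfl
      exact (p.adj_getVert_succ hj).1
  have hfar : ∀ i j, i + 3 ≤ j → j ≤ p.length →
      dg G (p.getVert i) + dg G (p.getVert j) < Fintype.card V := by
    intro i j hij hj
    by_contra hcon
    push Not at hcon
    obtain ⟨w, h1, h2, h3⟩ := hF.exists_simplicial_common (hinj i j (by omega) hj)
      (fun h => by have := (hadj i j (by omega) hj).1 h; omega) hcon
    have hw : w ∈ Dᶜ := fun h => hD w h h3
    have e1 : (inside G Dᶜ).Adj (p.getVert i) w := ⟨h1, hout i (by omega), hw⟩
    have e2 : (inside G Dᶜ).Adj w (p.getVert j) := ⟨h2.symm, hw, hout j hj⟩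
    have := SimpleGraph.dist_le (SimpleGraph.Walk.cons e1 e2.toWalk)
    have h4 := hdist i j (by omega) hj
    simp at this
    omega
  have hfin := heavy_end_of_long_path hP hinj hadj hfar (p.length - 5) 0 (by omega)
  have key : ∀ u, Fintype.card V ≤ dg G u + dg G m → u = m ∨ F.Adj m u := by
    intro u hu
    by_cases hum : u = m
    · exact Or.inl hum
    · exact Or.inr (hF.adj_of_oGraph (Or.inr ⟨Ne.symm hum, by omega⟩))
  simp only [zero_add, show p.length - 5 + 5 = p.length by omega, p.getVert_zero,
    p.getVert_length] at hfin
  rcases hfin with h | h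
  · refine hx (key x ?_)
    have h1 := hm x
    have h2 := hm (p.getVert 1)
    omega
  · refine hy (key y ?_)
    have h1 := hm y
    have h2 := hm (p.getVert (p.length - 5 + 4))
    omega

/-- Every long induced path of `F` starts or ends near `m`. -/
theorem Closed.end_near_of_induced_path [DecidableRel G.Adj] (hF : Closed G F) (hG : ClawHeavy G)
    (hP : P6GammaHeavy G gamma2) {m : V} (hm : ∀ v, dg G v ≤ dg G m) {z : ℕ → V} {N : ℕ}
    (hN : 5 ≤ N) (hinj : ∀ i j, i ≤ N → j ≤ N → z i = z j → i = j)
    (hadj : ∀ i j, i ≤ N → j ≤ N → (F.Adj (z i) (z j) ↔ i + 1 = j ∨ j + 1 = i)) :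
    (z 0 = m ∨ F.Adj m (z 0)) ∨ (z N = m ∨ F.Adj m (z N)) := by
  by_contra hcon
  push Not at hcon
  set D : Set V := {v | ¬ Simplicial F v ∧ ∀ i ≤ N, v ≠ z i} with hDdef
  have hz : ∀ i ≤ N, z i ∈ Dᶜ := fun i hi h => h.2 i hi rfl
  have hconn : ∀ i ≤ N, ConnIn F Dᶜ (z 0) (z i) := by
    intro i
    induction i with
    | zero => intro _; exact Relation.ReflTransGen.refl
    | succ i ih =>
      intro hi
      exact (ih (by omega)).tail ⟨(hadj i (i + 1) (by omega) hi).2 (Or.inl rfl), hz i (by omega),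
        hz _ hi⟩
  obtain ⟨p, hp⟩ := hF.exists_short_walk hG hP hm (D := D) (fun v hv => hv.1) (hconn N le_rfl)
    (not_or.2 hcon.1) (not_or.2 hcon.2)
  have key : ∀ k ≤ p.length, ∀ i ≤ N, (p.getVert k = z i → i ≤ k) ∧
      (F.Adj (p.getVert k) (z i) → i ≤ k + 1) := by
    intro k
    induction k with
    | zero =>
      intro _ i hi
      rw [p.getVert_zero]
      refine ⟨fun h => (hinj 0 i (by omega) hi h).symm.le, fun h => ?_⟩
      have := (hadj 0 i (by omega) hi).1 h
      omega
    | succ k ih =>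
      intro hk
      have ih := ih (by omega)
      have hkk := p.adj_getVert_succ (i := k) (by omega)
      have hFk := hF.le hkk.1
      have first : ∀ i ≤ N, p.getVert (k + 1) = z i → i ≤ k + 1 :=
        fun i hi h => (ih i hi).2 (h ▸ hFk)
      refine fun i hi => ⟨first i hi, fun h => ?_⟩
      by_cases hs : Simplicial F (p.getVert (k + 1))
      · by_cases hki : p.getVert k = z i
        · have := (ih i hi).1 hki
          omega
        · have := (ih i hi).2 (hs _ _ hFk.symm h hki)
          omega
      · have hnot : p.getVert (k + 1) ∉ D := hkk.2.2
        obtain ⟨j, hj, hkj⟩ : ∃ j ≤ N, p.getVert (k + 1) = z j := by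
          by_contra hno
          exact hnot ⟨hs, fun j hj e => hno ⟨j, hj, e⟩⟩
        have h1 := first j hj hkj
        rw [hkj, hadj j i hj hi] at h
        omega
  have := (key p.length le_rfl N le_rfl).1 (p.getVert_length)
  omega

end

section

variable {V : Type*} {G F : SimpleGraph V} {v w a b x y z : V}

theorem line_comm (F : SimpleGraph V) (v w : V) : line F v w = line F w v :=
  Set.ext fun _ => and_comm

theorem left_mem_line (h : F.Adj v w) : v ∈ line F v w := ⟨Or.inl rfl, Or.inr h.symm⟩

theorem right_mem_line (h : F.Adj v w) : w ∈ line F v w := ⟨Or.inr h, Or.inl rfl⟩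

variable [Fintype V]

theorem Closed.line_clique (hF : Closed G F) (h : F.Adj v w) (ha : a ∈ line F v w)
    (hb : b ∈ line F v w) (hab : a ≠ b) : F.Adj a b := by
  obtain ⟨ha1, ha2⟩ := ha
  obtain ⟨hb1, hb2⟩ := hb
  rcases ha1 with rfl | ha1
  · exact hb1.resolve_left hab.symm
  rcases ha2 with rfl | ha2
  · exact hb2.resolve_left hab.symm
  rcases hb1 with rfl | hb1
  · exact ha1.symm
  rcases hb2 with rfl | hb2
  · exact ha2.symm
  exact hF.diamond v w a b h ha1 hb1 ha2 hb2 hab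

theorem Closed.line_subset (hF : Closed G F) (h : F.Adj v w) (ha : a ∈ line F v w)
    (hb : b ∈ line F v w) (hab : a ≠ b) : line F a b ⊆ line F v w := by
  have hadj := hF.line_clique h ha hb hab
  have key : ∀ p, (a = p ∨ F.Adj p a) → (b = p ∨ F.Adj p b) → ∀ t ∈ line F a b,
      t = p ∨ F.Adj p t := by
    rintro p hpa hpb t ⟨hta, htb⟩
    rcases hpa with rfl | hpa
    · exact hta
    rcases hpb with rfl | hpb
    · exact htb
    rcases hta with rfl | hta
    · exact Or.inr hpa
    rcases htb with rfl | htb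
    · exact Or.inr hpb
    by_cases htp : t = p
    · exact Or.inl htp
    · exact Or.inr (hF.diamond a b p t hadj hpa.symm hta hpb.symm htb (Ne.symm htp))
  exact fun t ht => ⟨key v ha.1 hb.1 t ht, key w ha.2 hb.2 t ht⟩

theorem Closed.line_eq (hF : Closed G F) (h : F.Adj v w) (ha : a ∈ line F v w)
    (hb : b ∈ line F v w) (hab : a ≠ b) : line F a b = line F v w := by
  refine (hF.line_subset h ha hb hab).antisymm (hF.line_subset (hF.line_clique h ha hb hab) ?_ ?_
    h.ne)
  · exact ⟨ha.1.imp Eq.symm fun h => h.symm, hb.1.imp Eq.symm fun h => h.symm⟩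
  · exact ⟨ha.2.imp Eq.symm fun h => h.symm, hb.2.imp Eq.symm fun h => h.symm⟩

/-- The two lines through a vertex; a simplicial vertex also lies on a trivial line. -/
theorem Closed.exists_ends (hF : Closed G F) (hv : ∃ w, F.Adj v w) :
    ∃ e : Sym2 (Set V), ¬ e.IsDiag ∧ ∀ x, x ∈ e ↔
      (∃ w, F.Adj v w ∧ x = line F v w) ∨ (x = {v} ∧ Simplicial F v) := by
  by_cases hs : Simplicial F v
  · obtain ⟨w, hw⟩ := hv
    refine ⟨s(line F v w, {v}), ?_, fun x => ?_⟩
    · rw [Sym2.mk_isDiag_iff]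
      intro h
      have : w ∈ ({v} : Set V) := h ▸ right_mem_line hw
      exact hw.ne this.symm
    · rw [Sym2.mem_iff]
      refine or_congr ⟨fun h => ⟨w, hw, h⟩, ?_⟩ (by simp [hs])
      rintro ⟨w', hw', rfl⟩
      by_cases h : w' = w
      · rw [h]
      · exact hF.line_eq hw (left_mem_line hw) ⟨Or.inr hw', Or.inr (hs _ _ hw hw' (Ne.symm h))⟩
          hw'.ne
  · unfold Simplicial at hs
    push Not at hs
    obtain ⟨u, w, hu, hw, huw, hn⟩ := hs
    refine ⟨s(line F v u, line F v w), ?_, fun x => ?_⟩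
    · rw [Sym2.mk_isDiag_iff]
      intro h
      have : w ∈ line F v u := h ▸ right_mem_line hw
      rcases this.2 with h | h
      exacts [huw h.symm, hn h]
    · rw [Sym2.mem_iff]
      constructor
      · rintro (rfl | rfl)
        exacts [Or.inl ⟨u, hu, rfl⟩, Or.inl ⟨w, hw, rfl⟩]
      · rintro (⟨t, ht, rfl⟩ | ⟨-, hs⟩)
        · have key : ∀ p, F.Adj v p → (t = p ∨ F.Adj p t) → line F v t = line F v p :=
            fun p hp h => hF.line_eq hp (left_mem_line hp) ⟨Or.inr ht, h⟩ ht.ne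
          by_cases htu : t = u
          · exact Or.inl (key u hu (Or.inl htu))
          by_cases htw : t = w
          · exact Or.inr (key w hw (Or.inl htw))
          rcases hF.claw v t u w htu htw huw ht hu hw with h | h | h
          · exact Or.inl (key u hu (Or.inr h.symm))
          · exact Or.inr (key w hw (Or.inr h.symm))
          · exact absurd h hn
        · exact absurd (hs u w hu hw huw) hn

/-- `φ` represents `F` as the line graph of a simple triangle-free graph. -/
structure LineRep {V W : Type*} (F : SimpleGraph V) (φ : V → Sym2 W) : Prop where
  inj : Function.Injective φ
  not_diag : ∀ v, ¬ (φ v).IsDiag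
  adj : ∀ v w, F.Adj v w ↔ v ≠ w ∧ ∃ x, x ∈ φ v ∧ x ∈ φ w
  no_triangle : ∀ a b c u v w, φ u = s(a, b) → φ v = s(b, c) → φ w = s(a, c) → False

theorem Closed.exists_lineRep (hF : Closed G F) (hv : ∀ v, ∃ w, F.Adj v w) :
    ∃ φ : V → Sym2 (Set V), LineRep F φ := by
  choose φ hd hφ using fun v => hF.exists_ends (hv v)
  have hmem : ∀ v x, x ∈ φ v → v ∈ x := by
    intro v x hx
    rcases (hφ v x).1 hx with ⟨w, hw, rfl⟩ | ⟨rfl, -⟩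
    exacts [left_mem_line hw, rfl]
  have hshare : ∀ v w x, x ∈ φ v → x ∈ φ w → v ≠ w → F.Adj v w ∧ x = line F v w := by
    intro v w x h1 h2 hvw
    have hwx := hmem w x h2
    rcases (hφ v x).1 h1 with ⟨u, hu, rfl⟩ | ⟨rfl, -⟩
    · exact ⟨hF.line_clique hu (left_mem_line hu) hwx hvw,
        (hF.line_eq hu (left_mem_line hu) hwx hvw).symm⟩
    · exact absurd hwx.symm hvw
  refine ⟨φ, fun v w hvw => ?_, hd, fun v w => ⟨fun h => ⟨h.ne, line F v w, ?_, ?_⟩, ?_⟩, ?_⟩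
  · by_contra hne
    obtain ⟨x, y, hxy⟩ : ∃ x y, φ v = s(x, y) := by
      induction h : φ v with | _ x y => exact ⟨x, y, rfl⟩
    have h1 := hshare v w x (by simp [hxy]) (by simp [← hvw, hxy]) hne
    have h2 := hshare v w y (by simp [hxy]) (by simp [← hvw, hxy]) hne
    refine hd v ?_
    rw [hxy, Sym2.mk_isDiag_iff, h1.2, h2.2]
  · exact (hφ v _).2 (Or.inl ⟨w, h, rfl⟩)
  · exact (hφ w _).2 (Or.inl ⟨v, h.symm, line_comm F v w⟩)
  · rintro ⟨h, x, h1, h2⟩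
    exact (hshare v w x h1 h2 h).1
  · intro a b c u v w hu hv' hw
    have hab : a ≠ b := fun h => hd u (by rw [hu, h]; simp)
    have hbc : b ≠ c := fun h => hd v (by rw [hv', h]; simp)
    have hac : a ≠ c := fun h => hd w (by rw [hw, h]; simp)
    have huv : u ≠ v := by
      rintro rfl
      rw [hu, Sym2.eq_iff] at hv'
      tauto
    have huw : u ≠ w := by
      rintro rfl
      rw [hu, Sym2.eq_iff] at hw
      tauto
    have hvw : v ≠ w := by
      rintro rfl
      rw [hv', Sym2.eq_iff] at hw
      rcases hw with h | h
      exacts [hab h.1.symm, hbc h.1]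
    have h1 := hshare u v b (by simp [hu]) (by simp [hv']) huv
    have h2 := hshare u w a (by simp [hu]) (by simp [hw]) huw
    have h3 := hshare v w c (by simp [hv']) (by simp [hw]) hvw
    refine hab ?_
    rw [h1.2, h2.2]
    exact hF.line_eq h1.1 (left_mem_line h1.1) ⟨Or.inr h2.1, Or.inr h3.1⟩ huw

end

section

variable {V W : Type*} {F : SimpleGraph V} {φ : V → Sym2 W}

/-- The root graph of a line graph representation. -/
def rootGraph (φ : V → Sym2 W) : SimpleGraph W := SimpleGraph.fromEdgeSet (Set.range φ)

theorem LineRep.root_adj (hφ : LineRep F φ) {x y : W} :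
    (rootGraph φ).Adj x y ↔ ∃ v, φ v = s(x, y) := by
  rw [rootGraph, SimpleGraph.fromEdgeSet_adj]
  refine ⟨fun h => h.1, fun h => ⟨h, ?_⟩⟩
  rintro rfl
  obtain ⟨v, hv⟩ := h
  exact hφ.not_diag v (by rw [hv]; simp)

theorem LineRep.triangle_free (hφ : LineRep F φ) {x y z : W} (h1 : (rootGraph φ).Adj x y)
    (h2 : (rootGraph φ).Adj y z) (h3 : (rootGraph φ).Adj x z) : False := by
  obtain ⟨u, hu⟩ := hφ.root_adj.1 h1
  obtain ⟨v, hv⟩ := hφ.root_adj.1 h2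
  obtain ⟨w, hw⟩ := hφ.root_adj.1 h3
  exact hφ.no_triangle _ _ _ u v w hu hv hw

/-- Walks of `F` avoiding a vertex give walks of the root graph avoiding the
corresponding edge. -/
theorem LineRep.reachable_avoiding (hφ : LineRep F φ) {m a b : V} {x y : W} (ha : a ≠ m)
    (h : ConnIn F {m}ᶜ a b) (hx : x ∈ φ a) (hy : y ∈ φ b) :
    ((rootGraph φ).deleteEdges {φ m}).Reachable x y := by
  have step : ∀ c ≠ m, ∀ u v, u ∈ φ c → v ∈ φ c →
      ((rootGraph φ).deleteEdges {φ m}).Reachable u v := by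
    intro c hc u v hu hv
    by_cases huv : u = v
    · rw [huv]
    · have e : φ c = s(u, v) := (Sym2.mem_and_mem_iff huv).1 ⟨hu, hv⟩
      refine SimpleGraph.Adj.reachable ?_
      rw [SimpleGraph.deleteEdges_adj]
      refine ⟨hφ.root_adj.2 ⟨c, e⟩, ?_⟩
      rw [← e]
      exact fun h => hc (hφ.inj h)
  induction h generalizing y with
  | refl => exact step a ha x y hx hy
  | tail _ h ih =>
    obtain ⟨-, u, hu1, hu2⟩ := (hφ.adj _ _).1 h.1
    exact (ih hu1).trans (step _ h.2.2 u y hu2 hy)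

/-- Long paths of the root graph start or end near `φ m`. -/
theorem LineRep.end_near_of_path (hφ : LineRep F φ) {m : V}
    (hstar : ∀ (N : ℕ) (z : ℕ → V), 5 ≤ N → (∀ i j, i ≤ N → j ≤ N → z i = z j → i = j) →
      (∀ i j, i ≤ N → j ≤ N → (F.Adj (z i) (z j) ↔ i + 1 = j ∨ j + 1 = i)) →
      (z 0 = m ∨ F.Adj m (z 0)) ∨ (z N = m ∨ F.Adj m (z N)))
    {x y : W} (p : (rootGraph φ).Walk x y) (hp : p.IsPath) (hl : 6 ≤ p.length) :
    (p.getVert 0 ∈ φ m ∨ p.getVert 1 ∈ φ m) ∨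
      (p.getVert (p.length - 1) ∈ φ m ∨ p.getVert p.length ∈ φ m) := by
  have hex : ∀ i, ∃ v, i < p.length → φ v = s(p.getVert i, p.getVert (i + 1)) := by
    intro i
    by_cases hi : i < p.length
    · obtain ⟨v, hv⟩ := hφ.root_adj.1 (p.adj_getVert_succ hi)
      exact ⟨v, fun _ => hv⟩
    · obtain ⟨v, -⟩ := hφ.root_adj.1 (p.adj_getVert_succ (i := 0) (by omega))
      exact ⟨v, fun h => absurd h hi⟩
  choose z hz using hex
  have hinj : ∀ i j, i ≤ p.length → j ≤ p.length → p.getVert i = p.getVert j → i = j :=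
    fun i j hi hj h => hp.getVert_injOn hi hj h
  have hshare : ∀ i j, i < p.length → j < p.length →
      ((∃ x, x ∈ φ (z i) ∧ x ∈ φ (z j)) ↔ i = j ∨ i + 1 = j ∨ j + 1 = i) := by
    intro i j hi hj
    rw [hz i hi, hz j hj]
    constructor
    · rintro ⟨x, h1, h2⟩
      rw [Sym2.mem_iff] at h1 h2
      rcases h1 with rfl | rfl <;> rcases h2 with h | h <;>
        have := hinj _ _ (by omega) (by omega) h <;> omega
    · rintro (rfl | rfl | rfl)
      · exact ⟨_, Sym2.mem_mk_left _ _, Sym2.mem_mk_left _ _⟩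
      · exact ⟨_, Sym2.mem_mk_right _ _, Sym2.mem_mk_left _ _⟩
      · exact ⟨_, Sym2.mem_mk_left _ _, Sym2.mem_mk_right _ _⟩
  have hzinj : ∀ i j, i < p.length → j < p.length → z i = z j → i = j := by
    intro i j hi hj h
    have h1 := hz i hi
    rw [h, hz j hj, Sym2.eq_iff] at h1
    rcases h1 with h1 | h1
    · exact (hinj _ _ (by omega) (by omega) h1.1).symm
    · have h2 := hinj _ _ (by omega) (by omega) h1.1
      have h3 := hinj _ _ (by omega) (by omega) h1.2
      omega
  have near : ∀ i < p.length, z i = m ∨ F.Adj m (z i) →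
      p.getVert i ∈ φ m ∨ p.getVert (i + 1) ∈ φ m := by
    intro i hi h
    have : ∃ x ∈ φ m, x ∈ φ (z i) := by
      rcases h with h | h
      · exact ⟨p.getVert i, by rw [← h, hz i hi]; simp, by rw [hz i hi]; simp⟩
      · exact ((hφ.adj _ _).1 h).2
    obtain ⟨x, h1, h2⟩ := this
    rw [hz i hi, Sym2.mem_iff] at h2
    rcases h2 with rfl | rfl
    exacts [Or.inl h1, Or.inr h1]
  have hzadj : ∀ i j, i ≤ p.length - 1 → j ≤ p.length - 1 →
      (F.Adj (z i) (z j) ↔ i + 1 = j ∨ j + 1 = i) := by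
    intro i j hi hj
    rw [hφ.adj, hshare i j (by omega) (by omega)]
    constructor
    · rintro ⟨h1, rfl | h2⟩
      exacts [absurd rfl h1, h2]
    · intro h
      refine ⟨fun e => ?_, Or.inr h⟩
      have := hzinj i j (by omega) (by omega) e
      omega
  rcases hstar (p.length - 1) z (by omega)
    (fun i j hi hj => hzinj i j (by omega) (by omega)) hzadj with h | h
  · exact Or.inl (near 0 (by omega) h)
  · have := near (p.length - 1) (by omega) h
    rw [show p.length - 1 + 1 = p.length by omega] at this
    exact Or.inr this

end

section

variable {W : Type*}

/-- The parity of the degree of a vertex. -/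
noncomputable def par (T : SimpleGraph W) (x : W) : ZMod 2 := ((T.neighborSet x).ncard : ZMod 2)

open Classical in
/-- The graph formed by the edges of a walk. -/
def walkGraph {G : SimpleGraph W} {a b : W} (w : G.Walk a b) : SimpleGraph W :=
  SimpleGraph.fromEdgeSet {e | e ∈ w.edges}

theorem walkGraph_adj {G : SimpleGraph W} {a b x y : W} {w : G.Walk a b} :
    (walkGraph w).Adj x y ↔ s(x, y) ∈ w.edges := by
  rw [walkGraph, SimpleGraph.fromEdgeSet_adj]
  exact ⟨fun h => h.1, fun h => ⟨h, (w.adj_of_mem_edges h).ne⟩⟩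

theorem walkGraph_le {G : SimpleGraph W} {a b : W} (w : G.Walk a b) : walkGraph w ≤ G :=
  fun _ _ h => w.adj_of_mem_edges (walkGraph_adj.1 h)

theorem par_symmDiff [Finite W] (T R : SimpleGraph W) (x : W) :
    par (symmDiff T R) x = par T x + par R x := by
  have h : (symmDiff T R).neighborSet x = symmDiff (T.neighborSet x) (R.neighborSet x) := by
    ext y
    simp [symmDiff]
  have h1 := Set.ncard_inter_add_ncard_sdiff_eq_ncard (T.neighborSet x) (R.neighborSet x)
    (Set.toFinite _)
  have h2 := Set.ncard_inter_add_ncard_sdiff_eq_ncard (R.neighborSet x) (T.neighborSet x)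
    (Set.toFinite _)
  rw [Set.inter_comm] at h2
  have h3 : ((symmDiff T R).neighborSet x).ncard
      = (T.neighborSet x \ R.neighborSet x).ncard + (R.neighborSet x \ T.neighborSet x).ncard := by
    rw [h, Set.symmDiff_def, Set.ncard_union_eq (by
      rw [Set.disjoint_left]; rintro a ⟨h1, h2⟩ ⟨h3, h4⟩; exact h2 h3)
      (Set.toFinite _) (Set.toFinite _)]
  unfold par
  rw [h3, ← h1, ← h2]
  push_cast
  have h2 : ∀ c : ZMod 2, c + c = 0 := by decide
  linear_combination -h2 ((T.neighborSet x ∩ R.neighborSet x).ncard : ZMod 2)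

open Classical in
theorem par_edge (a b : W) (hab : a ≠ b) (x : W) :
    par (SimpleGraph.edge a b) x = (if x = a then 1 else 0) + (if x = b then 1 else 0) := by
  unfold par
  by_cases h1 : x = a
  · subst h1
    have : (SimpleGraph.edge x b).neighborSet x = {b} := by
      ext y; simp [SimpleGraph.edge_adj]; grind
    rw [this]; simp [hab]
  · by_cases h2 : x = b
    · subst h2
      have : (SimpleGraph.edge a x).neighborSet x = {a} := by
        ext y; simp [SimpleGraph.edge_adj]; grind
      rw [this]; simp [h1]
    · have : (SimpleGraph.edge a b).neighborSet x = ∅ := by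
        ext y; simp [SimpleGraph.edge_adj]; grind
      rw [this]; simp [h1, h2]

open Classical in
theorem par_walkGraph [Finite W] {G : SimpleGraph W} {a b : W} (w : G.Walk a b) (hw : w.IsTrail)
    (x : W) : par (walkGraph w) x = (if x = a then 1 else 0) + (if x = b then 1 else 0) := by
  induction w with
  | nil =>
    rename_i u
    have : (walkGraph (SimpleGraph.Walk.nil : G.Walk u u)).neighborSet x = ∅ := by
      ext y; simp [walkGraph_adj]
    unfold par
    rw [this]
    have h2 : ∀ c : ZMod 2, c + c = 0 := by decide
    simp [h2]
  | cons h w ih =>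
    rename_i u v z
    rw [SimpleGraph.Walk.isTrail_cons] at hw
    have : walkGraph (SimpleGraph.Walk.cons h w)
        = symmDiff (SimpleGraph.edge u v) (walkGraph w) := by
      ext y z
      have h3 : s(y, z) = s(u, v) → (walkGraph w).Adj y z → False := by
        intro h4 h5
        rw [walkGraph_adj, h4] at h5
        exact hw.2 h5
      simp only [walkGraph_adj, SimpleGraph.Walk.edges_cons, List.mem_cons, symmDiff,
        SimpleGraph.sup_adj, SimpleGraph.sdiff_adj, SimpleGraph.edge_adj] at h3 ⊢
      have h6 := h.ne
      have h7 : s(y, z) = s(u, v) ↔ y = u ∧ z = v ∨ y = v ∧ z = u := Sym2.eq_iff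
      grind
    rw [this, par_symmDiff, ih hw.1, par_edge _ _ h.ne]
    have h2 : ∀ a b c : ZMod 2, a + b + (b + c) = a + c := by decide
    exact h2 _ _ _

open Classical in
/-- A graph with an odd vertex has another one in the same component. -/
theorem exists_odd_reachable [Finite W] (T : SimpleGraph W) (a : W) (ha : par T a = 1) :
    ∃ b, b ≠ a ∧ par T b = 1 ∧ T.Reachable a b := by
  have := Fintype.ofFinite W
  let T' : SimpleGraph W :=
    { Adj := fun x y => T.Adj x y ∧ T.Reachable a x
      symm := ⟨fun x y h => ⟨h.1.symm, h.2.trans h.1.reachable⟩⟩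
      loopless := ⟨fun x h => h.1.ne rfl⟩ }
  have hdeg : ∀ x, T.Reachable a x → (T'.degree x : ZMod 2) = par T x := by
    intro x hx
    rw [par, ← SimpleGraph.card_neighborFinset_eq_degree, SimpleGraph.neighborFinset,
      ← Set.ncard_eq_toFinset_card']
    congr 2
    ext y
    simp [T', hx]
  have hodd : ∀ x, T.Reachable a x → (Odd (T'.degree x) ↔ par T x = 1) := by
    intro x hx
    rw [← hdeg x hx, ZMod.natCast_eq_one_iff_odd]
  obtain ⟨b, hb, hb'⟩ := T'.exists_ne_odd_degree_of_exists_odd_degree a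
    ((hodd a (SimpleGraph.Reachable.refl _)).2 ha)
  have hab : T.Reachable a b := by
    obtain ⟨y, hy⟩ := (T'.degree_pos_iff_exists_adj b).1 hb'.pos
    exact hy.2
  exact ⟨b, hb, (hodd b hab).1 hb', hab⟩

end

section

variable {W : Type*}

theorem exists_walk_first {G : SimpleGraph W} (P : W → Prop) {x y : W} (w : G.Walk x y)
    (hy : P y) : ∃ b, ∃ r : G.Walk x b, r.IsPath ∧ P b ∧ (∀ z ∈ r.support, P z → z = b) ∧
      r.support ⊆ w.support := by
  classical
  suffices h : ∃ b, ∃ r : G.Walk x b, P b ∧ (∀ z ∈ r.support, P z → z = b) ∧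
      r.support ⊆ w.support by
    obtain ⟨b, r, hb, hr, hrw⟩ := h
    have := r.support_bypass_subset_support
    exact ⟨b, r.bypass, r.bypass_isPath, hb, fun z hz => hr z (this hz),
      fun z hz => hrw (this hz)⟩
  induction w with
  | nil => exact ⟨_, SimpleGraph.Walk.nil, hy, by simp, by simp⟩
  | cons h w ih =>
    rename_i u v z
    by_cases hu : P u
    · exact ⟨u, SimpleGraph.Walk.nil, hu, by simp, by simp⟩
    · obtain ⟨b, r, hb, hr, hrw⟩ := ih hy
      refine ⟨b, SimpleGraph.Walk.cons h r, hb, ?_, ?_⟩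
      · intro c hc hPc
        rw [SimpleGraph.Walk.support_cons, List.mem_cons] at hc
        rcases hc with rfl | hc
        exacts [absurd hPc hu, hr c hc hPc]
      · rw [SimpleGraph.Walk.support_cons, SimpleGraph.Walk.support_cons]
        exact List.cons_subset_cons _ hrw

theorem eq_of_mem_of_isPath_append {G : SimpleGraph W} {x y z u : W} {w : G.Walk x y}
    {w' : G.Walk y z} (h : (w.append w').IsPath) (hu : u ∈ w.support) (hu' : u ∈ w'.support) :
    u = y := by
  rw [SimpleGraph.Walk.isPath_def, SimpleGraph.Walk.support_append, List.nodup_append] at h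
  rw [← SimpleGraph.Walk.cons_tail_support, List.mem_cons] at hu'
  exact hu'.resolve_right fun h' => h.2.2 u hu u h' rfl

theorem isPath_append {G : SimpleGraph W} {x y z : W} {w : G.Walk x y} {w' : G.Walk y z}
    (hw : w.IsPath) (hw' : w'.IsPath) (h : ∀ u ∈ w.support, u ∈ w'.support → u = y) :
    (w.append w').IsPath := by
  rw [SimpleGraph.Walk.isPath_def, SimpleGraph.Walk.support_append, List.nodup_append]
  have h1 := hw'.support_nodup
  rw [← SimpleGraph.Walk.cons_tail_support, List.nodup_cons] at h1
  refine ⟨hw.support_nodup, h1.2, ?_⟩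
  rintro a ha b hb rfl
  have := h a ha (List.mem_of_mem_tail hb)
  subst this
  exact h1.1 hb

open Classical in
theorem reachable_of_par [Finite W] {T : SimpleGraph W} {a b : W} (hab : a ≠ b)
    (h : ∀ x, par T x = (if x = a then 1 else 0) + (if x = b then 1 else 0)) :
    T.Reachable a b := by
  obtain ⟨c, hca, hc, hac⟩ := exists_odd_reachable T a (by rw [h]; simp [hab])
  rw [h, if_neg hca, zero_add] at hc
  have : c = b := by
    by_contra hcb
    rw [if_neg hcb] at hc
    exact absurd hc (by decide)
  rwa [← this]

theorem exists_closed_trail [Finite W] (T : SimpleGraph W) (hT : ∀ x, par T x = 0) (p : W) :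
    ∃ x, ∃ c : T.Walk x x, c.IsTrail ∧ T.Reachable p x ∧
      ∀ y, T.Reachable p y → y ∈ c.support := by
  classical
  have := Fintype.ofFinite W
  let L : Set ℕ := {n | ∃ x, ∃ c : T.Walk x x, c.IsTrail ∧ T.Reachable p x ∧ c.length = n}
  have hfin : L.Finite := by
    refine (Set.finite_Iic T.edgeFinset.card).subset ?_
    rintro n ⟨x, c, hc, -, rfl⟩
    exact hc.length_le_card_edgeFinset
  obtain ⟨n, ⟨x, c, hc, hx, hn⟩, hmax⟩ := Set.exists_max_image L id hfin
    ⟨0, p, SimpleGraph.Walk.nil, by simp, SimpleGraph.Reachable.refl _, rfl⟩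
  refine ⟨x, c, hc, hx, fun y hy => ?_⟩
  by_contra hyc
  obtain ⟨q⟩ := hx.symm.trans hy
  obtain ⟨d, -, hu, hv⟩ := q.exists_boundary_dart {z | z ∈ c.support} c.start_mem_support hyc
  obtain ⟨⟨u, v⟩, huv⟩ := d
  simp only [Set.mem_ofPred_eq] at hu hv
  have huvc : s(u, v) ∉ c.edges := fun h => hv (c.snd_mem_support_of_mem_edges h)
  have hr : (symmDiff (symmDiff T (walkGraph c)) (SimpleGraph.edge u v)).Reachable v u := by
    refine reachable_of_par huv.ne.symm fun z => ?_
    rw [par_symmDiff, par_symmDiff, hT, par_walkGraph c hc, par_edge _ _ huv.ne]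
    have : ∀ a b c : ZMod 2, 0 + (a + a) + (b + c) = c + b := by decide
    exact this _ _ _
  have hle : ∀ y z, (symmDiff (symmDiff T (walkGraph c)) (SimpleGraph.edge u v)).Adj y z →
      T.Adj y z ∧ s(y, z) ∉ c.edges ∧ s(y, z) ≠ s(u, v) := by
    intro y z h
    have h1 : (walkGraph c).Adj y z → T.Adj y z := fun h => walkGraph_le c h
    have h6 : T.Adj u v := huv
    have h5 := h6.symm
    have h2 : (SimpleGraph.edge u v).Adj y z ↔ (y = u ∧ z = v ∨ y = v ∧ z = u) := by
      rw [SimpleGraph.edge_adj]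
      exact ⟨fun h => h.1, fun h => ⟨h, by rintro rfl; have := h6.ne; grind⟩⟩
    have h3 : s(y, z) = s(u, v) ↔ y = u ∧ z = v ∨ y = v ∧ z = u := Sym2.eq_iff
    have h4 : s(y, z) = s(u, v) → ¬ (walkGraph c).Adj y z := by
      intro h h'
      rw [walkGraph_adj, h] at h'
      exact huvc h'
    simp only [symmDiff, SimpleGraph.sup_adj, SimpleGraph.sdiff_adj] at h
    rw [← walkGraph_adj]
    grind
  obtain ⟨r, hrp⟩ := hr.exists_isPath
  let r' : T.Walk v u := r.mapLe (fun y z h => (hle y z h).1)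
  have hr'e : r'.edges = r.edges := by simp [r']
  have hre : ∀ e ∈ r.edges, e ∉ c.edges ∧ e ≠ s(u, v) := by
    intro e he
    have := r.edges_subset_edgeSet he
    induction e with
    | _ y z => exact (hle y z this).2
  let c' : T.Walk u u := (c.rotate u hu).append (SimpleGraph.Walk.cons huv r')
  have hrot : ∀ e, e ∈ (c.rotate u hu).edges ↔ e ∈ c.edges := fun e =>
    (c.rotate_edges u hu).perm.mem_iff
  have hc' : c'.IsTrail := by
    rw [SimpleGraph.Walk.isTrail_def, SimpleGraph.Walk.edges_append, List.nodup_append]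
    refine ⟨(hc.rotate hu).edges_nodup, ?_, ?_⟩
    · rw [SimpleGraph.Walk.edges_cons, List.nodup_cons, hr'e]
      exact ⟨fun h => (hre _ h).2 rfl, hrp.isTrail.edges_nodup⟩
    · rintro e he e' he' rfl
      rw [hrot] at he
      rw [SimpleGraph.Walk.edges_cons, List.mem_cons, hr'e] at he'
      rcases he' with rfl | he'
      exacts [huvc he, (hre _ he').1 he]
  have hlen : c'.length = c.length + (r'.length + 1) := by
    rw [SimpleGraph.Walk.length_append, SimpleGraph.Walk.length_cons]
    congr 1
    rw [← SimpleGraph.Walk.length_edges, (c.rotate_edges u hu).perm.length_eq,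
      SimpleGraph.Walk.length_edges]
  have := hmax c'.length ⟨u, c', hc', hx.trans ⟨c.takeUntil u hu⟩, rfl⟩
  simp only [id, hlen, ← hn] at this
  omega

/-- A closed trail of the root graph meeting all its edges yields a Hamilton cycle. -/
theorem LineRep.hamL_of_closed_trail {V : Type*} [Fintype V] {F : SimpleGraph V} {φ : V → Sym2 W}
    (hφ : LineRep F φ) (h3 : 3 ≤ Fintype.card V) {x : W} (c : (rootGraph φ).Walk x x)
    (hc : c.IsTrail) (hdom : ∀ v, ∃ y ∈ c.support, y ∈ φ v) : HamL F := by
  classical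
  have key : ∀ {a b : W} (w : (rootGraph φ).Walk a b), w.IsTrail → ∀ D : Finset V,
      (∀ v ∈ D, ∃ y ∈ w.support, y ∈ φ v) → (∀ v, φ v ∈ w.edges → v ∈ D) →
      ∃ l : List V, l.Nodup ∧ (∀ v, v ∈ l ↔ v ∈ D) ∧ l.IsChain F.Adj ∧
        (∀ h ∈ l.head?, a ∈ φ h) ∧ (∀ h ∈ l.getLast?, b ∈ φ h) ∧ (l = [] → a = b) := by
    have hstar : ∀ (a : W) (D : Finset V), (∀ v ∈ D, a ∈ φ v) → D.toList.IsChain F.Adj := by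
      intro a D hD
      apply List.Pairwise.isChain
      refine List.Pairwise.imp_of_mem ?_ (Finset.nodup_toList D)
      intro u v hu hv huv
      exact (hφ.adj u v).2 ⟨huv, a, hD u (Finset.mem_toList.1 hu), hD v (Finset.mem_toList.1 hv)⟩
    intro a b w
    induction w with
    | nil =>
      rename_i u
      intro _ D hD _
      have hD' : ∀ v ∈ D, u ∈ φ v := by
        intro v hv
        obtain ⟨y, hy, h⟩ := hD v hv
        simp at hy
        exact hy ▸ h
      refine ⟨D.toList, D.nodup_toList, by simp, hstar u D hD', ?_, ?_, fun _ => rfl⟩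
      · intro h hh
        exact hD' h (Finset.mem_toList.1 (List.mem_of_head? hh))
      · intro h hh
        exact hD' h (Finset.mem_toList.1 (List.mem_of_getLast? hh))
    | cons hadj w ih =>
      rename_i a c b
      intro hw D hD hwD
      rw [SimpleGraph.Walk.isTrail_cons] at hw
      obtain ⟨v₀, hv₀⟩ := hφ.root_adj.1 hadj
      have hv₀D : v₀ ∈ D := hwD v₀ (by simp [hv₀])
      let D' := D.filter fun v => a ∉ φ v ∨ φ v ∈ w.edges
      let X := (D \ D').erase v₀
      have hv₀D' : v₀ ∉ D' := by
        simp only [D', Finset.mem_filter, not_and, not_or]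
        intro _
        refine ⟨by simp [hv₀], hv₀ ▸ hw.2⟩
      have hX : ∀ v ∈ X, a ∈ φ v := by
        intro v hv
        simp only [X, D', Finset.mem_erase, Finset.mem_sdiff, Finset.mem_filter, not_and,
          not_or, not_not] at hv
        exact (hv.2.2 hv.2.1).1
      obtain ⟨l, h1, h2, h3, h4, h5, h6⟩ := ih hw.1 D' (by
        intro v hv
        rw [Finset.mem_filter] at hv
        rcases hv.2 with h | h
        · obtain ⟨y, hy, hyv⟩ := hD v hv.1
          rw [SimpleGraph.Walk.support_cons, List.mem_cons] at hy
          rcases hy with rfl | hy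
          exacts [absurd hyv h, ⟨y, hy, hyv⟩]
        · rcases hz : φ v with ⟨y, z⟩
          exact ⟨y, w.fst_mem_support_of_mem_edges (by rw [hz] at h; exact h),
            Sym2.mem_mk_left _ _⟩)
        (by
        intro v hv
        exact Finset.mem_filter.2 ⟨hwD v (by simp [hv]), Or.inr hv⟩)
      refine ⟨X.toList ++ v₀ :: l, ?_, ?_, ?_, ?_, ?_, by simp⟩
      · rw [List.nodup_append, List.nodup_cons]
        refine ⟨X.nodup_toList, ⟨by rwa [h2], h1⟩, ?_⟩
        rintro u hu v hv rfl
        rw [Finset.mem_toList] at hu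
        simp only [X, Finset.mem_erase, Finset.mem_sdiff] at hu
        rw [List.mem_cons, h2] at hv
        rcases hv with hv | hv
        exacts [hu.1 hv, hu.2.2 hv]
      · intro v
        rw [List.mem_append, Finset.mem_toList, List.mem_cons, h2]
        simp only [X, Finset.mem_erase, Finset.mem_sdiff]
        have : v ∈ D' → v ∈ D := fun h => (Finset.mem_filter.1 h).1
        grind
      · rw [List.isChain_append]
        refine ⟨hstar a X hX, ?_, ?_⟩
        · rw [List.isChain_cons]
          refine ⟨fun u hu => (hφ.adj _ _).2 ⟨?_, c, by simp [hv₀], h4 u hu⟩, h3⟩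
          rintro rfl
          exact hv₀D' ((h2 _).1 (List.mem_of_head? hu))
        · intro u hu v hv
          simp at hv
          subst hv
          have huX := Finset.mem_toList.1 (List.mem_of_getLast? hu)
          exact (hφ.adj _ _).2 ⟨(Finset.mem_erase.1 huX).1, a, hX u huX, by simp [hv₀]⟩
      · intro h hh
        rw [List.head?_append] at hh
        rcases hl : X.toList with _ | ⟨u, t⟩
        · rw [hl] at hh
          simp at hh
          simp [← hh, hv₀]
        · rw [hl] at hh
          simp at hh
          rw [← hh]
          exact hX u (Finset.mem_toList.1 (by simp [hl]))
      · intro h hh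
        rw [List.getLast?_append_of_ne_nil _ (by simp)] at hh
        rcases l with _ | ⟨u, t⟩
        · simp at hh
          rw [← hh, hv₀, ← h6 rfl]
          simp
        · exact h5 h (by simpa using hh)
  obtain ⟨l, h1, h2, h3', h4, h5, -⟩ := key c hc Finset.univ (fun v _ => hdom v)
    (fun v _ => Finset.mem_univ v)
  have hspan : Spanning l := ⟨h1, fun v => (h2 v).2 (Finset.mem_univ v)⟩
  have hlen : 3 ≤ l.length := by rw [hspan.length]; exact h3
  have hne : l ≠ [] := by rintro rfl; simp at hlen
  refine ⟨l.head hne, l.getLast hne, l,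
    ⟨h3', List.head?_eq_some_head hne, List.getLast?_eq_some_getLast hne⟩, hspan, ?_⟩
  refine (hφ.adj _ _).2 ⟨?_, x, h5 _ (List.getLast?_eq_some_getLast hne),
    h4 _ (List.head?_eq_some_head hne)⟩
  intro h
  rw [List.getLast_eq_getElem, List.head_eq_getElem, h1.getElem_inj_iff] at h
  omega

end

section

variable {W : Type*} {H T : SimpleGraph W} {p q : W}

theorem walkGraph_reachable {G : SimpleGraph W} {a b z : W} (w : G.Walk a b)
    (hz : z ∈ w.support) : (walkGraph w).Reachable a z := by
  induction w with
  | nil => simp at hz; rw [hz]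
  | cons h w ih =>
    rename_i u v b
    rw [SimpleGraph.Walk.support_cons, List.mem_cons] at hz
    rcases hz with rfl | hz
    · exact SimpleGraph.Reachable.refl _
    · have h1 : (walkGraph (SimpleGraph.Walk.cons h w)).Adj u v := by simp [walkGraph_adj]
      refine h1.reachable.trans ((ih hz).mono ?_)
      intro x y hxy
      rw [walkGraph_adj] at hxy ⊢
      simp [hxy]

theorem reachable_of_adj {T' : SimpleGraph W} (h : ∀ x y, T.Adj x y → T'.Reachable x y) {x y : W}
    (hxy : T.Reachable x y) : T'.Reachable x y := by
  obtain ⟨w⟩ := hxy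
  induction w with
  | nil => exact SimpleGraph.Reachable.refl _
  | cons h' w ih => exact (h _ _ h').trans ih

/-- The situation in the root graph `H` of a nonhamiltonian closed graph, where `pq` is the edge
of `H` that corresponds to a vertex of maximum degree. -/
structure Core (H : SimpleGraph W) (p q : W) : Prop where
  pq : H.Adj p q
  tri : ∀ x y z, H.Adj x y → H.Adj y z → H.Adj x z → False
  conn : ∀ x y x' y', H.Adj x x' → H.Adj y y' → H.Reachable x y
  bridge : ∀ a b x x' y y', H.Adj a b → H.Adj x x' → H.Adj y y' → s(x, x') ≠ s(a, b) →
    s(y, y') ≠ s(a, b) → (H.deleteEdges {s(a, b)}).Reachable x y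
  star : ∀ x y x' y' (w : H.Walk x y), w.IsPath → 4 ≤ w.length → H.Adj x x' → H.Adj y y' →
    x' ∉ w.support → y' ∉ w.support → x' ≠ y' →
      (x' ∈ s(p, q) ∨ x ∈ s(p, q)) ∨ (y ∈ s(p, q) ∨ y' ∈ s(p, q))
  pend : (∀ y, H.Adj p y → y = q) → ∀ y, H.Adj q y → y = p
  dom : ∀ T ≤ H, (∀ x, par T x = 0) →
    ∃ y y', H.Adj y y' ∧ ¬ T.Reachable p y ∧ ¬ T.Reachable p y'

/-- An even subgraph whose component at `p` contains `q`, if possible. -/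
structure Cand (H : SimpleGraph W) (p q : W) (T : SimpleGraph W) : Prop where
  le : T ≤ H
  even : ∀ x, par T x = 0
  reach : T.Reachable p q ∨ ∀ y, H.Adj q y → y = p

/-- A candidate dominating as many edges as possible. -/
structure MaxCand (H : SimpleGraph W) (p q : W) (T : SimpleGraph W) : Prop
    extends Cand H p q T where
  inside : ∀ x y, T.Adj x y → T.Reachable p x
  max : ∀ T', Cand H p q T' →
    (∃ y y', H.Adj y y' ∧ T'.Reachable p y ∧ ¬ T.Reachable p y ∧ ¬ T.Reachable p y') →
    ∃ y y', H.Adj y y' ∧ T.Reachable p y ∧ ¬ T'.Reachable p y ∧ ¬ T'.Reachable p y'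

theorem Core.exists_cand [Finite W] (hH : Core H p q) : ∃ T, Cand H p q T := by
  by_cases hq : ∀ y, H.Adj q y → y = p
  · refine ⟨⊥, bot_le, fun x => ?_, Or.inr hq⟩
    simp [par]
  · have hp : ¬ ∀ y, H.Adj p y → y = q := fun h => hq (hH.pend h)
    push Not at hq hp
    obtain ⟨y, hy, hyp⟩ := hq
    obtain ⟨z, hz, hzq⟩ := hp
    have h1 := hH.pq.ne
    obtain ⟨r, hr⟩ := (hH.bridge p q p z q y hH.pq hz hy
      (by rw [Ne, Sym2.eq_iff]; grind) (by rw [Ne, Sym2.eq_iff]; grind)).exists_isPath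
    have hrpq : ¬ (walkGraph r).Adj p q := by
      intro h
      have := walkGraph_le r h
      simp at this
    refine ⟨symmDiff (walkGraph r) (SimpleGraph.edge p q), ?_, fun x => ?_, Or.inl ?_⟩
    · refine symmDiff_le_sup.trans (sup_le ?_ ?_)
      · exact (walkGraph_le r).trans (SimpleGraph.deleteEdges_le _)
      · rw [SimpleGraph.edge_le_iff]
        exact Or.inr hH.pq
    · rw [par_symmDiff, par_walkGraph r hr.isTrail, par_edge _ _ hH.pq.ne]
      have : ∀ c : ZMod 2, c + c = 0 := by decide
      exact this _
    · have : (symmDiff (walkGraph r) (SimpleGraph.edge p q)).Adj p q := by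
        simp [symmDiff, SimpleGraph.edge_adj, hrpq, h1]
      exact this.reachable

theorem Core.exists_maxCand [Finite W] (hH : Core H p q) : ∃ T, MaxCand H p q T := by
  obtain ⟨T₀, hT₀⟩ := hH.exists_cand
  let D : SimpleGraph W → Set (Sym2 W) := fun T => {e | e ∈ H.edgeSet ∧ ∃ x ∈ e, T.Reachable p x}
  obtain ⟨T, hT, hmax⟩ := Set.exists_max_image {T | Cand H p q T} (fun T => (D T).ncard)
    (Set.toFinite _) ⟨T₀, hT₀⟩
  have hT : Cand H p q T := hT
  let T' : SimpleGraph W :=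
    { Adj := fun x y => T.Adj x y ∧ T.Reachable p x
      symm := ⟨fun x y h => ⟨h.1.symm, h.2.trans h.1.reachable⟩⟩
      loopless := ⟨fun x h => h.1.ne rfl⟩ }
  have hle : T' ≤ T := fun x y h => h.1
  have hreach : ∀ x y, T.Reachable p x → T.Reachable x y → T'.Reachable x y := by
    rintro x y hx ⟨w⟩
    induction w with
    | nil => exact SimpleGraph.Reachable.refl _
    | cons h w ih =>
      have h1 : T'.Adj _ _ := ⟨h, hx⟩
      exact h1.reachable.trans (ih (hx.trans h.reachable))
  have hiff : ∀ x, T'.Reachable p x ↔ T.Reachable p x := fun x =>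
    ⟨fun h => h.mono hle, fun h => hreach p x (SimpleGraph.Reachable.refl _) h⟩
  refine ⟨T', ⟨hle.trans hT.le, fun x => ?_, ?_⟩, fun x y h => (hiff x).2 h.2, fun T'' h h' => ?_⟩
  · by_cases hx : T.Reachable p x
    · rw [← hT.even x, par, par]
      congr 2
      ext y
      simp [T', hx]
    · have : T'.neighborSet x = ∅ := by
        ext y
        simp [T', hx]
      simp [par, this]
  · rw [hiff]
    exact hT.reach
  · simp only [hiff] at h' ⊢
    by_contra! hcon
    obtain ⟨y, y', hyy', h1, h2, h3⟩ := h'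
    have hss : D T ⊂ D T'' := by
      rw [Set.ssubset_iff_of_subset]
      · refine ⟨s(y, y'), ⟨hyy', y, by simp, h1⟩, ?_⟩
        rintro ⟨-, x, hx, hx'⟩
        rw [Sym2.mem_iff] at hx
        rcases hx with rfl | rfl <;> contradiction
      · rintro e ⟨he, x, hx, hxT⟩
        refine ⟨he, ?_⟩
        obtain ⟨z, rfl⟩ := hx
        by_cases hxT' : T''.Reachable p x
        · exact ⟨x, by simp, hxT'⟩
        · exact ⟨z, by simp, hcon x z he hxT hxT'⟩
    have := Set.ncard_lt_ncard hss (Set.toFinite _)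
    have := hmax T'' h
    omega

namespace MaxCand

/-- The component of a maximal candidate cannot be enlarged. -/
theorem not_enlarge (hT : MaxCand H p q T) {T' : SimpleGraph W} {d d' : W} (hle : T' ≤ H)
    (heven : ∀ x, par T' x = 0) (hdd : H.Adj d d') (hd : ¬ T.Reachable p d)
    (hd' : ¬ T.Reachable p d') (hsub : ∀ x y, T.Adj x y → T'.Reachable x y)
    (hd'' : T'.Reachable p d) : False := by
  obtain ⟨y, y', -, h1, h2, -⟩ := hT.max T'
    ⟨hle, heven, hT.reach.imp_left (reachable_of_adj hsub)⟩ ⟨d, d', hdd, hd'', hd, hd'⟩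
  exact h2 (reachable_of_adj hsub h1)

end MaxCand

/-- A tail `A d d'` attached to the component at `p`. -/
structure Tail (H T : SimpleGraph W) (p A d d' : W) : Prop where
  mem : T.Reachable p A
  adj : H.Adj A d
  adj' : H.Adj d d'
  fst : ¬ T.Reachable p d
  snd : ¬ T.Reachable p d'

theorem Tail.not_mem (hH : Core H p q) (hT : MaxCand H p q T) {A d d' : W}
    (h : Tail H T p A d d') : d ∉ s(p, q) ∧ d' ∉ s(p, q) := by
  have hp : ∀ x, ¬ T.Reachable p x → x ≠ p := by
    rintro x hx rfl
    exact hx (SimpleGraph.Reachable.refl _)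
  have hq : ∀ x y, H.Adj x y → ¬ T.Reachable p x → ¬ T.Reachable p y → x ≠ q := by
    rintro x y hxy hx hy rfl
    rcases hT.reach with h1 | h1
    · exact hx h1
    · exact hp y hy (h1 y hxy)
  rw [Sym2.mem_iff, Sym2.mem_iff, not_or, not_or]
  exact ⟨⟨hp _ h.fst, hq _ _ h.adj' h.fst h.snd⟩, ⟨hp _ h.snd, hq _ _ h.adj'.symm h.snd h.fst⟩⟩

theorem Tail.star (hH : Core H p q) (hT : MaxCand H p q T) {A d d' y y' : W}
    (h : Tail H T p A d d') (w : T.Walk y A) (hw : w.IsPath) (hl : 3 ≤ w.length)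
    (hy : H.Adj y y') (hy' : y' ∉ w.support) (hd : y' ≠ d) (hd' : y' ≠ d') :
    y ∈ s(p, q) ∨ y' ∈ s(p, q) := by
  have hS : ∀ z ∈ w.support, T.Reachable p z := by
    intro z hz
    classical
    exact h.mem.trans ((w.dropUntil z hz).reachable.symm)
  let w' : H.Walk y d := (w.mapLe hT.le).concat h.adj
  have hs : ∀ z, z ∈ w'.support ↔ z ∈ w.support ∨ z = d := by
    intro z; simp [w', SimpleGraph.Walk.support_concat]
  have hw' : w'.IsPath := by
    refine SimpleGraph.Walk.IsPath.concat (by simpa using hw) ?_ _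
    intro hh
    exact h.fst (hS d (by simpa using hh))
  have hn := h.not_mem hH hT
  rcases hH.star y d y' d' w' hw' (by simp [w']; omega) hy h.adj'
    (by rw [hs]; tauto) (by
      rw [hs]; rintro (hh | rfl)
      · exact h.snd (hS _ hh)
      · exact h.adj'.ne rfl) hd' with hh | hh
  · exact hh.symm
  · tauto

end

section

variable {W : Type*} {H T : SimpleGraph W} {p q : W}

/-- A path `R` of `H` from `A` to `B` outside the component of `T` at `p`, with tails at both
ends. -/
structure Ear (H T : SimpleGraph W) (p : W) {A B : W} (R : H.Walk A B) (d d' e e' : W) :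
    Prop where
  ne : A ≠ B
  left : Tail H T p A d d'
  right : Tail H T p B e e'
  path : R.IsPath
  out : ∀ z ∈ R.support, T.Reachable p z → z = A ∨ z = B
  edge : ∀ x y, s(x, y) ∈ R.edges → T.Reachable p x → ¬ T.Reachable p y
  left_mem : d ∈ R.support
  right_mem : e ∈ R.support
  away : ∀ y y', H.Adj y y' → T.Reachable p y → y' ∉ R.support → y' ≠ d' ∧ y' ≠ e'

theorem not_both_of_only_last {P : W → Prop} {G : SimpleGraph W} {a b : W} {r : G.Walk a b}
    (hr : ∀ z ∈ r.support, P z → z = b) {x y : W} (h : s(x, y) ∈ r.edges) (hx : P x) : ¬ P y := by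
  intro hy
  have h1 := hr x (r.fst_mem_support_of_mem_edges h) hx
  have h2 := hr y (r.snd_mem_support_of_mem_edges h) hy
  exact (r.adj_of_mem_edges h).ne (h1.trans h2.symm)

theorem Core.exists_ear_of_path (hH : Core H p q) {A B d d' : W} (ht : Tail H T p A d d')
    (hAB : A ≠ B) (hB : T.Reachable p B) (r : H.Walk d B) (hr : r.IsPath)
    (hrS : ∀ z ∈ r.support, T.Reachable p z → z = B) :
    ∃ B' d' e e', ∃ R : H.Walk A B', Ear H T p R d d' e e' := by
  by_cases hy : ∃ y, T.Reachable p y ∧ H.Adj d' y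
  · obtain ⟨y, hy, hdy⟩ := hy
    have hAy : A ≠ y := by
      rintro rfl
      exact hH.tri A d d' ht.adj ht.adj' hdy.symm
    have h1 := ht.fst
    have h2 := ht.snd
    have h3 := ht.mem
    have h4 := ht.adj'.ne
    have n1 : A ≠ d := ht.adj.ne
    have n2 : A ≠ d' := by rintro rfl; exact h2 h3
    have n3 : d ≠ y := by rintro rfl; exact h1 hy
    have n4 : d' ≠ y := hdy.ne
    refine ⟨y, d', d', d, .cons ht.adj (.cons ht.adj' (.cons hdy .nil)), hAy, ht,
      ⟨hy, hdy.symm, ht.adj'.symm, h2, h1⟩, ?_, ?_, ?_, by simp, by simp, ?_⟩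
    · simp [SimpleGraph.Walk.cons_isPath_iff, *]
    · intro z hz hzS
      simp at hz
      rcases hz with rfl | rfl | rfl | rfl <;> tauto
    · intro x y' h hx hy'
      simp at h
      grind
    · intro z z' _ _ hz'
      simp at hz'
      tauto
  · push Not at hy
    have hA : A ∉ r.support := fun h => hAB (hrS A h ht.mem)
    have hRpath : (SimpleGraph.Walk.cons ht.adj r).IsPath := by
      rw [SimpleGraph.Walk.cons_isPath_iff]
      exact ⟨hr, hA⟩
    have hout : ∀ z ∈ (SimpleGraph.Walk.cons ht.adj r).support, T.Reachable p z →
        z = A ∨ z = B := by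
      intro z hz hzS
      rw [SimpleGraph.Walk.support_cons, List.mem_cons] at hz
      exact hz.imp_right fun h => hrS z h hzS
    have hedge : ∀ x y, s(x, y) ∈ (SimpleGraph.Walk.cons ht.adj r).edges →
        T.Reachable p x → ¬ T.Reachable p y := by
      intro x y h hx hy
      rw [SimpleGraph.Walk.edges_cons, List.mem_cons] at h
      rcases h with h | h
      · rw [Sym2.eq_iff] at h
        have := ht.fst
        rcases h with ⟨rfl, rfl⟩ | ⟨rfl, rfl⟩ <;> contradiction
      · exact not_both_of_only_last hrS h hx hy
    have hmem : ∀ i, r.getVert i ∈ (SimpleGraph.Walk.cons ht.adj r).support := fun i => by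
      rw [SimpleGraph.Walk.support_cons]
      exact List.mem_cons_of_mem _ (r.getVert_mem_support i)
    have hnot : ∀ i < r.length, ¬ T.Reachable p (r.getVert i) := by
      intro i hi h
      have h1 := hrS _ (r.getVert_mem_support i) h
      have h2 := hr.getVert_injOn (x₁ := i) (x₂ := r.length) (show i ≤ r.length by omega)
        (show r.length ≤ r.length from le_rfl)
        (by rw [h1, r.getVert_length])
      omega
    have hpos : 0 < r.length := by
      rw [Nat.pos_iff_ne_zero]
      intro h
      rw [SimpleGraph.Walk.eq_of_length_eq_zero h] at ht
      exact ht.fst hB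
    have h0 : r.getVert 0 = d := r.getVert_zero
    have hn : r.getVert r.length = B := r.getVert_length
    have hd : d ∈ (SimpleGraph.Walk.cons ht.adj r).support := by simp
    by_cases h1 : r.length = 1
    · have hdB : H.Adj d B := by
        have := r.adj_getVert_succ (i := 0) (by omega)
        rwa [h0, show 0 + 1 = r.length by omega, hn] at this
      refine ⟨B, d', d, d', .cons ht.adj r, hAB, ht, ⟨hB, hdB.symm, ht.adj', ht.fst, ht.snd⟩,
        hRpath, hout, hedge, hd, hd, ?_⟩
      intro y y' hyy hyS _
      rw [and_self]
      rintro rfl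
      exact hy y hyS hyy.symm
    · have a1 := r.adj_getVert_succ (i := 0) (by omega)
      have a2 := r.adj_getVert_succ (i := r.length - 1) (by omega)
      have a3 := r.adj_getVert_succ (i := r.length - 2) (by omega)
      rw [show r.length - 1 + 1 = r.length by omega, hn] at a2
      rw [show r.length - 2 + 1 = r.length - 1 by omega] at a3
      rw [h0] at a1
      refine ⟨B, r.getVert 1, r.getVert (r.length - 1), r.getVert (r.length - 2),
        .cons ht.adj r, hAB, ⟨ht.mem, ht.adj, a1, ht.fst, hnot 1 (by omega)⟩,
        ⟨hB, a2.symm, a3.symm, hnot _ (by omega), hnot _ (by omega)⟩, hRpath, hout, hedge,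
        hd, hmem _, ?_⟩
      intro y y' _ _ h
      exact ⟨fun e => h (e ▸ hmem _), fun e => h (e ▸ hmem _)⟩

theorem Core.exists_ear [Finite W] (hH : Core H p q) (hT : MaxCand H p q T) :
    ∃ A B d d' e e', ∃ R : H.Walk A B, Ear H T p R d d' e e' := by
  have htail : ∃ A d d', Tail H T p A d d' := by
    obtain ⟨y, y', hyy', hy, hy'⟩ := hH.dom T hT.le hT.even
    obtain ⟨w⟩ := hH.conn y p y' q hyy' hH.pq
    have hp : T.Reachable p p := SimpleGraph.Reachable.refl _
    suffices ∀ {a b : W} (w : H.Walk a b), T.Reachable p b → ¬ T.Reachable p a →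
        (∃ a', H.Adj a a' ∧ ¬ T.Reachable p a') → ∃ A d d', Tail H T p A d d' from
      this w hp hy ⟨y', hyy', hy'⟩
    intro a b w
    induction w with
    | nil => intro h h'; contradiction
    | cons h w ih =>
      rename_i u v b
      rintro hb hu ⟨u', hu', hu''⟩
      by_cases hv : T.Reachable p v
      · exact ⟨v, u, u', hv, h.symm, hu', hu, hu''⟩
      · exact ih hb hv ⟨u, h.symm, hu⟩
  obtain ⟨A, d, d', ht⟩ := htail
  have hpp : T.Reachable p p := SimpleGraph.Reachable.refl _
  have hdp : d ≠ p := by rintro rfl; exact ht.fst hpp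
  have hd'p : d' ≠ p := by rintro rfl; exact ht.snd hpp
  have hdq : d ≠ q := by
    have := (ht.not_mem hH hT).1
    rw [Sym2.mem_iff] at this
    tauto
  have hAd : A ≠ d' := by rintro rfl; exact ht.snd ht.mem
  obtain ⟨w⟩ := hH.bridge d A d d' p q ht.adj.symm ht.adj' hH.pq
    (by rw [Ne, Sym2.eq_iff]; have := ht.adj'.ne; grind)
    (by rw [Ne, Sym2.eq_iff]; grind)
  obtain ⟨B, r, hr, hB, hrS, -⟩ := exists_walk_first (fun z => T.Reachable p z) w hpp
  have hle : H.deleteEdges {s(d, A)} ≤ H := SimpleGraph.deleteEdges_le _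
  by_cases hAB : A = B
  · subst hAB
    exfalso
    have hTr : ∀ x y, T.Adj x y → ¬ (walkGraph r).Adj x y := by
      intro x y hxy h
      rw [walkGraph_adj] at h
      exact not_both_of_only_last hrS h (hT.inside x y hxy) (hT.inside y x hxy.symm)
    have hsub : ∀ x y, T.Adj x y →
        (symmDiff (symmDiff T (walkGraph r)) (SimpleGraph.edge d A)).Adj x y := by
      intro x y hxy
      have h1 := hTr x y hxy
      have h2 : ¬ (SimpleGraph.edge d A).Adj x y := by
        intro h
        rw [SimpleGraph.edge_adj] at h
        rcases h.1 with ⟨rfl, rfl⟩ | ⟨rfl, rfl⟩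
        exacts [ht.fst (hT.inside _ _ hxy), ht.fst (hT.inside _ _ hxy.symm)]
      simp [symmDiff, hxy, h1, h2]
    refine hT.not_enlarge (T' := symmDiff (symmDiff T (walkGraph r)) (SimpleGraph.edge d A))
      ?_ ?_ ht.adj' ht.fst ht.snd (fun x y h => (hsub x y h).reachable) ?_
    · refine symmDiff_le_sup.trans (sup_le (symmDiff_le_sup.trans (sup_le hT.le ?_)) ?_)
      · exact (walkGraph_le r).trans hle
      · rw [SimpleGraph.edge_le_iff]
        exact Or.inr ht.adj.symm
    · intro x
      rw [par_symmDiff, par_symmDiff, hT.even, par_walkGraph r hr.isTrail,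
        par_edge _ _ ht.adj.ne.symm]
      have : ∀ c : ZMod 2, 0 + c + c = 0 := by decide
      exact this _
    · have h1 : (symmDiff (symmDiff T (walkGraph r)) (SimpleGraph.edge d A)).Adj A d := by
        have h1 : ¬ T.Adj A d := fun h => ht.fst (hT.inside _ _ h.symm)
        have h2 : ¬ (walkGraph r).Adj A d := by
          intro h
          have := walkGraph_le r h
          simp at this
        have := ht.adj.ne
        simp [symmDiff, SimpleGraph.edge_adj, h1, h2, this]
      exact (reachable_of_adj (fun x y h => (hsub x y h).reachable) ht.mem).trans h1.reachable
  · obtain ⟨B', d₁, e, e', R, hR⟩ := hH.exists_ear_of_path ht hAB hB (r.mapLe hle)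
      (by simpa using hr) (by simpa using hrS)
    exact ⟨A, B', d, d₁, e, e', R, hR⟩

theorem Ear.symm {A B d d' e e' : W} {R : H.Walk A B} (h : Ear H T p R d d' e e') :
    Ear H T p R.reverse e e' d d' where
  ne := h.ne.symm
  left := h.right
  right := h.left
  path := h.path.reverse
  out := fun z hz hz' => (h.out z (by simpa using hz) hz').symm
  edge := fun x y hxy => h.edge x y (by simpa using hxy)
  left_mem := by simpa using h.right_mem
  right_mem := by simpa using h.left_mem
  away := fun y y' h1 h2 h3 => (h.away y y' h1 h2 (by simpa using h3)).symm

variable {A B d d' e e' : W} {R : H.Walk A B}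

theorem Ear.not_adj_of_mem (h : Ear H T p R d d' e e') (hT : MaxCand H p q T) {x y : W}
    (hxy : T.Adj x y) : ¬ (walkGraph R).Adj x y := by
  intro h'
  exact h.edge x y (walkGraph_adj.1 h') (hT.inside x y hxy) (hT.inside y x hxy.symm)

/-- The ends of an ear are not adjacent. -/
theorem Ear.not_adj [Finite W] (hT : MaxCand H p q T)
    (h : Ear H T p R d d' e e') : ¬ H.Adj A B := by
  intro hAB
  let T' := symmDiff (symmDiff T (walkGraph R)) (SimpleGraph.edge A B)
  have hABR : ¬ (walkGraph R).Adj A B := by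
    intro h'
    exact h.edge A B (walkGraph_adj.1 h') h.left.mem h.right.mem
  have hRT : walkGraph R ≤ T' := by
    intro x y hxy
    have h1 : ¬ T.Adj x y := fun h' => h.not_adj_of_mem hT h' hxy
    have h2 : ¬ (SimpleGraph.edge A B).Adj x y := by
      intro h'
      rw [SimpleGraph.edge_adj] at h'
      rcases h'.1 with ⟨rfl, rfl⟩ | ⟨rfl, rfl⟩
      exacts [hABR hxy, hABR hxy.symm]
    simp [T', symmDiff, hxy, h1, h2]
  have hRreach : ∀ z ∈ R.support, T'.Reachable A z := fun z hz =>
    (walkGraph_reachable R hz).mono hRT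
  have hsub : ∀ x y, T.Adj x y → T'.Reachable x y := by
    intro x y hxy
    have hR := h.not_adj_of_mem hT hxy
    by_cases h2 : (SimpleGraph.edge A B).Adj x y
    · rw [SimpleGraph.edge_adj] at h2
      have := hRreach B R.end_mem_support
      rcases h2.1 with ⟨rfl, rfl⟩ | ⟨rfl, rfl⟩
      exacts [this, this.symm]
    · have : T'.Adj x y := by simp [T', symmDiff, hxy, hR, h2]
      exact this.reachable
  refine hT.not_enlarge (T' := T') ?_ ?_ h.left.adj' h.left.fst h.left.snd hsub ?_
  · refine symmDiff_le_sup.trans (sup_le (symmDiff_le_sup.trans (sup_le hT.le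
      (walkGraph_le R))) ?_)
    rw [SimpleGraph.edge_le_iff]
    exact Or.inr hAB
  · intro x
    rw [par_symmDiff, par_symmDiff, hT.even, par_walkGraph R h.path.isTrail,
      par_edge _ _ hAB.ne]
    have : ∀ c : ZMod 2, 0 + c + c = 0 := by decide
    exact this _
  · exact (reachable_of_adj hsub h.left.mem).trans (hRreach d h.left_mem)

end

section

variable {W : Type*} {H T : SimpleGraph W} {p q A B d d' e e' : W} {R : H.Walk A B}

/-- The graph obtained by deleting the edges of a walk. -/
def rest (P : T.Walk A B) : SimpleGraph W := T \ walkGraph P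

theorem rest_adj {P : T.Walk A B} {x y : W} :
    (rest P).Adj x y ↔ T.Adj x y ∧ s(x, y) ∉ P.edges := by
  rw [rest, SimpleGraph.sdiff_adj, walkGraph_adj]

theorem rest_le (P : T.Walk A B) : rest P ≤ T := sdiff_le

open Classical in
theorem par_rest [Finite W] (P : T.Walk A B) (hP : P.IsTrail) (x : W) :
    par (rest P) x = par T x + ((if x = A then 1 else 0) + (if x = B then 1 else 0)) := by
  rw [← par_walkGraph P hP, ← par_symmDiff, symmDiff_of_ge (walkGraph_le P), rest]

theorem reachable_rest_end [Finite W] (hT : ∀ x, par T x = 0) (hAB : A ≠ B) {P : T.Walk A B}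
    (hP : P.IsPath) : (rest P).Reachable A B := by
  classical
  exact reachable_of_par hAB fun x => by rw [par_rest P hP.isTrail, hT, zero_add]

/-- A walk reaching `P` only at its end avoids the edges of `P`. -/
theorem reachable_rest_of_first {P : T.Walk A B} {y x u : W} {g : T.Walk y x}
    (hg : ∀ z ∈ g.support, z ∈ P.support → z = x) (hu : u ∈ g.support) :
    (rest P).Reachable y u := by
  refine (walkGraph_reachable g hu).mono fun a b hab => rest_adj.2 ⟨walkGraph_le g hab, fun h => ?_⟩
  exact not_both_of_only_last hg (walkGraph_adj.1 hab) (P.fst_mem_support_of_mem_edges h)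
    (P.snd_mem_support_of_mem_edges h)

/-- From a vertex off the component of `A` in `rest P`, there are two ways to get there. -/
theorem exists_two_exits {P : T.Walk A B} (hP : P.IsPath) {y : W} (hy : T.Reachable A y)
    (hKy : ¬ (rest P).Reachable A y) (hKB : (rest P).Reachable A B) :
    ∃ z z', z ≠ z' ∧ ∀ c, c = z ∨ c = z' → (rest P).Reachable A c ∧
      ∃ g : T.Walk y c, g.IsPath ∧ ∀ u ∈ g.support, (rest P).Reachable A u → u = c := by
  classical
  obtain ⟨w⟩ := hy.symm
  obtain ⟨x, g, hg, hx, hgx, -⟩ := exists_walk_first (· ∈ P.support) w P.start_mem_support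
  have hgK : ∀ u ∈ g.support, ¬ (rest P).Reachable A u := fun u hu h =>
    hKy (h.trans (reachable_rest_of_first hgx hu).symm)
  have hKx := hgK x g.end_mem_support
  have main : ∀ {c : W} (w : T.Walk x c), w.support ⊆ P.support → (rest P).Reachable A c →
      ∃ z ∈ w.support, (rest P).Reachable A z ∧
        ∃ g : T.Walk y z, g.IsPath ∧ ∀ u ∈ g.support, (rest P).Reachable A u → u = z := by
    intro c w hwP hc
    obtain ⟨z, r, hr, hz, hrz, hrw⟩ := exists_walk_first (fun u => (rest P).Reachable A u) w hc
    refine ⟨z, hrw r.end_mem_support, hz, g.append r,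
      isPath_append hg hr fun u hu hu' => hgx u hu (hwP (hrw hu')), fun u hu hK => ?_⟩
    rw [SimpleGraph.Walk.mem_support_append_iff] at hu
    rcases hu with hu | hu
    exacts [absurd hK (hgK u hu), hrz u hu hK]
  obtain ⟨z, hz, h1⟩ := main (P.takeUntil x hx).reverse (by
    intro u hu
    rw [SimpleGraph.Walk.support_reverse, List.mem_reverse] at hu
    exact P.support_takeUntil_subset_support hx hu) (SimpleGraph.Reachable.refl _)
  obtain ⟨z', hz', h1'⟩ := main (P.dropUntil x hx) (P.support_dropUntil_subset_support hx) hKB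
  refine ⟨z, z', ?_, ?_⟩
  · rintro rfl
    rw [SimpleGraph.Walk.support_reverse, List.mem_reverse] at hz
    have := eq_of_mem_of_isPath_append (by rwa [P.take_spec hx]) hz hz'
    exact hKx (this ▸ h1.1)
  · rintro c (rfl | rfl)
    exacts [h1, h1']

theorem exists_long_path {G : SimpleGraph W} {z z' : W} (hAB : A ≠ B) (hadj : ¬ G.Adj A B)
    (hzz : z ≠ z') (hB : G.Reachable A B) (hz : G.Reachable A z) (hz' : G.Reachable A z') :
    ∃ c D, (c = z ∨ c = z') ∧ (D = A ∨ D = B) ∧ ∃ Q : G.Walk c D, Q.IsPath ∧ 2 ≤ Q.length := by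
  have main : ∀ {a b : W}, G.Reachable a b → a ≠ b → ¬ G.Adj a b →
      ∃ Q : G.Walk a b, Q.IsPath ∧ 2 ≤ Q.length := by
    intro a b h hab hadj
    obtain ⟨Q, hQ⟩ := h.exists_isPath
    refine ⟨Q, hQ, ?_⟩
    by_contra! hl
    interval_cases h : Q.length
    · exact hab (SimpleGraph.Walk.eq_of_length_eq_zero h)
    · exact hadj (SimpleGraph.Walk.adj_of_length_eq_one h)
  have main' : ∀ {c : W}, (c = z ∨ c = z') → G.Reachable A c →
      (∃ c D, (c = z ∨ c = z') ∧ (D = A ∨ D = B) ∧ ∃ Q : G.Walk c D, Q.IsPath ∧ 2 ≤ Q.length) ∨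
        (c ≠ A ∧ c ≠ B ∧ G.Adj c A ∧ G.Adj c B) := by
    intro c hc hAc
    by_cases h1 : c = A
    · exact Or.inl ⟨c, B, hc, Or.inr rfl, main (hAc.symm.trans hB) (h1 ▸ hAB) (h1 ▸ hadj)⟩
    by_cases h2 : c = B
    · exact Or.inl ⟨c, A, hc, Or.inl rfl, main hAc.symm h1 fun h => hadj (h2 ▸ h.symm)⟩
    by_cases h3 : G.Adj c A
    · by_cases h4 : G.Adj c B
      · exact Or.inr ⟨h1, h2, h3, h4⟩
      · exact Or.inl ⟨c, B, hc, Or.inr rfl, main (hAc.symm.trans hB) h2 h4⟩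
    · exact Or.inl ⟨c, A, hc, Or.inl rfl, main hAc.symm h1 h3⟩
  rcases main' (Or.inl rfl) hz with h | ⟨h1, h2, h3, h4⟩
  · exact h
  rcases main' (Or.inr rfl) hz' with h | ⟨h1', h2', h3', h4'⟩
  · exact h
  refine ⟨z, A, Or.inl rfl, Or.inl rfl, .cons h4 (.cons h4'.symm (.cons h3' .nil)), ?_, by simp⟩
  have := hAB.symm
  have := h2'.symm
  simp [SimpleGraph.Walk.cons_isPath_iff, *]

/-- Edges leaving the component of `A` in `rest P`, from a vertex of `T`, touch `pq`. -/
theorem Ear.exit [Finite W] (hR : Ear H T p R d d' e e') (hH : Core H p q)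
    (hT : MaxCand H p q T) {P : T.Walk A B} (hP : P.IsPath) {y y' : W} (hyy : H.Adj y y')
    (hy : T.Reachable p y) (hKy : ¬ (rest P).Reachable A y) (hKy' : ¬ (rest P).Reachable A y')
    (hy'R : y' ∉ R.support) : y ∈ s(p, q) ∨ y' ∈ s(p, q) := by
  classical
  have hKB := reachable_rest_end hT.even hR.ne hP
  obtain ⟨z, z', hzz, hz⟩ := exists_two_exits hP (hR.left.mem.symm.trans hy) hKy hKB
  obtain ⟨c, D, hc, hD, Q, hQ, hQl⟩ := exists_long_path hR.ne
    (fun h => hR.not_adj hT (hT.le (rest_le P h))) hzz hKB (hz z (Or.inl rfl)).1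
    (hz z' (Or.inr rfl)).1
  obtain ⟨hKc, g, hg, hgc⟩ := hz c hc
  obtain ⟨t, t', ht, htR, ht'⟩ : ∃ t t', Tail H T p D t t' ∧ t ∈ R.support ∧
      ∀ y y', H.Adj y y' → T.Reachable p y → y' ∉ R.support → y' ≠ t' := by
    rcases hD with rfl | rfl
    · exact ⟨d, d', hR.left, hR.left_mem, fun y y' h1 h2 h3 => (hR.away y y' h1 h2 h3).1⟩
    · exact ⟨e, e', hR.right, hR.right_mem, fun y y' h1 h2 h3 => (hR.away y y' h1 h2 h3).2⟩
  have hQK : ∀ u ∈ Q.support, (rest P).Reachable A u := fun u hu =>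
    hKc.trans (Q.takeUntil u hu).reachable
  let Q' : T.Walk c D := Q.mapLe (rest_le P)
  have hQ's : Q'.support = Q.support := by simp [Q']
  have hQ'l : Q'.length = Q.length := by simp [Q']
  have hQ' : Q'.IsPath := by simpa [Q'] using hQ
  by_cases hy'g : y' ∈ g.support
  · have hne : y' ≠ c := by rintro rfl; exact hKy' hKc
    have hydrop : y ∉ (g.dropUntil y' hy'g).support := by
      intro h
      exact hyy.ne (eq_of_mem_of_isPath_append (by rwa [g.take_spec hy'g])
        (g.takeUntil y' hy'g).start_mem_support h)
    have hlen : 1 ≤ (g.dropUntil y' hy'g).length := by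
      by_contra! h
      exact hne (SimpleGraph.Walk.eq_of_length_eq_zero (p := g.dropUntil y' hy'g) (by omega))
    refine (ht.star hH hT ((g.dropUntil y' hy'g).append Q') ?_ ?_ hyy.symm ?_ ?_ ?_).symm
    · refine isPath_append (hg.dropUntil hy'g) hQ' fun u hu hu' => ?_
      exact hgc u (g.support_dropUntil_subset_support hy'g hu) (hQK u (hQ's ▸ hu'))
    · rw [SimpleGraph.Walk.length_append]; omega
    · rw [SimpleGraph.Walk.mem_support_append_iff, hQ's]
      rintro (h | h)
      exacts [hydrop h, hKy (hQK y h)]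
    · rintro rfl; exact ht.fst hy
    · rintro rfl; exact ht.snd hy
  · have hlen : 1 ≤ g.length := by
      by_contra! h
      have := SimpleGraph.Walk.eq_of_length_eq_zero (p := g) (by omega)
      exact hKy (this ▸ hKc)
    refine ht.star hH hT (g.append Q') ?_ ?_ hyy ?_ ?_ ?_
    · exact isPath_append hg hQ' fun u hu hu' => hgc u hu (hQK u (hQ's ▸ hu'))
    · rw [SimpleGraph.Walk.length_append]; omega
    · rw [SimpleGraph.Walk.mem_support_append_iff, hQ's]
      rintro (h | h)
      exacts [hy'g h, hKy' (hQK y' h)]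
    · rintro rfl; exact hy'R htR
    · exact ht' y y' hyy hy hy'R

theorem Ear.not_reachable_rest [Finite W] (hR : Ear H T p R d d' e e') (hH : Core H p q)
    (hT : MaxCand H p q T) {P : T.Walk A B} (hP : P.IsPath) (hp : (rest P).Reachable A p)
    (hq : (rest P).Reachable A q ∨ ∀ y, H.Adj q y → y = p) : False := by
  classical
  let T' := symmDiff (rest P) (walkGraph R)
  have h1 : rest P ≤ T' := by
    intro x y h
    have := hR.not_adj_of_mem hT (rest_le P h)
    simp [T', symmDiff, h, this]
  have h2 : walkGraph R ≤ T' := by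
    intro x y h
    have : ¬ (rest P).Adj x y := fun h' => hR.not_adj_of_mem hT (rest_le P h') h
    simp [T', symmDiff, h, this]
  have hK : ∀ z, (rest P).Reachable A z → T'.Reachable p z := fun z hz => (hp.symm.trans hz).mono h1
  have hRz : ∀ z ∈ R.support, T'.Reachable p z := fun z hz =>
    (hK A (SimpleGraph.Reachable.refl _)).trans ((walkGraph_reachable R hz).mono h2)
  have hcand : Cand H p q T' := by
    refine ⟨symmDiff_le_sup.trans (sup_le ((rest_le P).trans hT.le) (walkGraph_le R)), ?_, ?_⟩
    · intro x
      rw [par_symmDiff, par_rest P hP.isTrail, hT.even, par_walkGraph R hR.path.isTrail]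
      have : ∀ c : ZMod 2, 0 + c + c = 0 := by decide
      exact this _
    · exact hq.imp_left (hK q)
  obtain ⟨y, y', hyy, hyS, hy, hy'⟩ := hT.max T' hcand
    ⟨d, d', hR.left.adj', hRz d hR.left_mem, hR.left.fst, hR.left.snd⟩
  have hn : ∀ y y', H.Adj y y' → ¬ T'.Reachable p y → ¬ T'.Reachable p y' → y ∉ s(p, q) := by
    intro y y' hyy hy hy' h
    rw [Sym2.mem_iff] at h
    have hpp : T'.Reachable p p := SimpleGraph.Reachable.refl _
    rcases h with rfl | rfl
    · exact hy hpp
    · rcases hq with hq | hq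
      · exact hy (hK _ hq)
      · exact hy' (hq y' hyy ▸ hpp)
  rcases hR.exit hH hT hP hyy hyS (fun h => hy (hK _ h)) (fun h => hy' (hK _ h))
    (fun h => hy' (hRz _ h)) with h | h
  exacts [hn _ _ hyy hy hy' h, hn _ _ hyy.symm hy' hy h]

theorem Ear.mem_of_not_reachable_rest [Finite W] (hR : Ear H T p R d d' e e') (hH : Core H p q)
    (hT : MaxCand H p q T) {P : T.Walk A B} (hP : P.IsPath) {u v : W} (huv : s(p, q) = s(u, v))
    (huS : T.Reachable p u) (hu : ¬ (rest P).Reachable A u) (hv : (rest P).Reachable A v) :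
    u ∈ P.support := by
  classical
  by_contra huP
  have hKB := reachable_rest_end hT.even hR.ne hP
  obtain ⟨w⟩ := huS.symm.trans hR.left.mem
  obtain ⟨x, g, hg, hx, hgx, -⟩ := exists_walk_first (· ∈ P.support) w P.start_mem_support
  have hux : (rest P).Reachable u x := reachable_rest_of_first hgx g.end_mem_support
  have hKx : ¬ (rest P).Reachable A x := fun h => hu (h.trans hux.symm)
  have hne : x ≠ u := by rintro rfl; exact huP hx
  have hnb : ∀ w, (rest P).Adj x w → w = u := by
    intro w hw
    have hKw : ¬ (rest P).Reachable A w := fun h => hKx (h.trans hw.symm.reachable)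
    have hTw := rest_le P hw
    have h := hR.exit hH hT hP (hT.le hTw) (hT.inside _ _ hTw) hKx hKw (fun h => by
      rcases hR.out w h (hT.inside _ _ hTw.symm) with rfl | rfl
      exacts [hKw (SimpleGraph.Reachable.refl _), hKw hKB])
    rw [huv, Sym2.mem_iff, Sym2.mem_iff] at h
    rcases h with (h | rfl) | (h | rfl)
    exacts [absurd h hne, absurd hv hKx, h, absurd hv hKw]
  have hset : (rest P).neighborSet x = {u} := by
    ext w
    refine ⟨fun h => hnb w h, ?_⟩
    rintro rfl
    obtain ⟨r⟩ := hux.symm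
    cases r with
    | nil => exact absurd rfl hne
    | cons h r => exact hnb _ h ▸ h
  have h1 := par_rest P hP.isTrail x
  rw [hT.even, if_neg (fun h : x = A => hKx (by rw [h])),
    if_neg (fun h : x = B => hKx (h ▸ hKB)), par, hset] at h1
  simp at h1

/-- The vertices `p` and `q` lie on different ones of two edge-disjoint paths of `T`. -/
theorem Ear.dichotomy [Finite W] (hR : Ear H T p R d d' e e') (hH : Core H p q)
    (hT : MaxCand H p q T) {P Q : T.Walk A B} (hP : P.IsPath) (hQ : Q.IsPath)
    (hPQ : ∀ f ∈ P.edges, f ∉ Q.edges) :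
    (p ∈ P.support ∧ q ∈ Q.support ∧ p ∉ Q.support ∧ q ∉ P.support) ∨
      (q ∈ P.support ∧ p ∈ Q.support ∧ q ∉ Q.support ∧ p ∉ P.support) := by
  have sub : ∀ {P Q : T.Walk A B}, (∀ f ∈ P.edges, f ∉ Q.edges) → ∀ z ∈ P.support,
      (rest Q).Reachable A z := by
    intro P Q h z hz
    refine (walkGraph_reachable P hz).mono fun a b hab => rest_adj.2 ⟨walkGraph_le P hab, ?_⟩
    exact h _ (walkGraph_adj.1 hab)
  have hQP : ∀ f ∈ Q.edges, f ∉ P.edges := fun f h h' => hPQ f h' h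
  have hcov : ∀ z, T.Reachable A z → (rest P).Reachable A z ∨ (rest Q).Reachable A z := by
    rintro z ⟨w⟩
    suffices ∀ {x z : W} (w : T.Walk x z), ((rest P).Reachable A x ∨ (rest Q).Reachable A x) →
        (rest P).Reachable A z ∨ (rest Q).Reachable A z from
      this w (Or.inl (SimpleGraph.Reachable.refl _))
    intro x z w
    induction w with
    | nil => exact id
    | cons h w ih =>
      rename_i x y z
      intro hx
      apply ih
      have step : ∀ {P Q : T.Walk A B}, (∀ f ∈ P.edges, f ∉ Q.edges) → (rest P).Reachable A x →
          (rest P).Reachable A y ∨ (rest Q).Reachable A y := by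
        intro P Q hPQ hx
        by_cases hP : s(x, y) ∈ P.edges
        · exact Or.inr (sub hPQ y (P.snd_mem_support_of_mem_edges hP))
        · have : (rest P).Adj x y := rest_adj.2 ⟨h, hP⟩
          exact Or.inl (hx.trans this.reachable)
      rcases hx with hx | hx
      exacts [step hPQ hx, (step hQP hx).symm]
  have hpS := hcov p hR.left.mem.symm
  have nP := hR.not_reachable_rest hH hT hP
  have nQ := hR.not_reachable_rest hH hT hQ
  have hq : ¬ ∀ y, H.Adj q y → y = p := by
    intro hq
    rcases hpS with h | h
    exacts [nP h (Or.inr hq), nQ h (Or.inr hq)]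
  have hpq : T.Reachable p q := hT.reach.resolve_right hq
  have hqS := hcov q (hR.left.mem.symm.trans hpq)
  have hpp : T.Reachable p p := SimpleGraph.Reachable.refl _
  have sP := sub hPQ
  have sQ := sub hQP
  have e1 : s(p, q) = s(q, p) := Sym2.eq_swap
  by_cases h1 : (rest P).Reachable A p
  · have h2 : ¬ (rest P).Reachable A q := fun h => nP h1 (Or.inl h)
    have h3 := hqS.resolve_left h2
    have h4 : ¬ (rest Q).Reachable A p := fun h => nQ h (Or.inl h3)
    exact Or.inr ⟨hR.mem_of_not_reachable_rest hH hT hP e1 hpq h2 h1,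
      hR.mem_of_not_reachable_rest hH hT hQ rfl hpp h4 h3, fun h => h2 (sQ q h),
      fun h => h4 (sP p h)⟩
  · have h3 := hpS.resolve_left h1
    have h4 : ¬ (rest Q).Reachable A q := fun h => nQ h3 (Or.inl h)
    have h2 := hqS.resolve_right h4
    exact Or.inl ⟨hR.mem_of_not_reachable_rest hH hT hP rfl hpp h1 h2,
      hR.mem_of_not_reachable_rest hH hT hQ e1 hpq h4 h3, fun h => h1 (sQ p h),
      fun h => h4 (sP q h)⟩

end

section

variable {W : Type*} {H T : SimpleGraph W} {p q A B d d' e e' : W} {R : H.Walk A B}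

theorem Tail.near_cons (h : Tail H T p A d d') (hH : Core H p q) (hT : MaxCand H p q T) {x y : W}
    (hxy : T.Adj x y) (w : T.Walk y A) (hw : (SimpleGraph.Walk.cons hxy w).IsPath)
    (hl : 3 ≤ w.length) : x ∈ s(p, q) ∨ y ∈ s(p, q) := by
  rw [SimpleGraph.Walk.cons_isPath_iff] at hw
  have hx := hT.inside _ _ hxy
  refine (h.star hH hT w hw.1 hl (hT.le hxy.symm) hw.2 ?_ ?_).symm
  · rintro rfl; exact h.fst hx
  · rintro rfl; exact h.snd hx

/-- Two edge-disjoint paths separating the two ends `u`, `v` of the edge `pq`. -/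
structure Split (p q u v : W) (P Q : T.Walk A B) : Prop where
  eq : s(p, q) = s(u, v)
  left : P.IsPath
  right : Q.IsPath
  disj : ∀ f ∈ P.edges, f ∉ Q.edges
  u_mem : u ∈ P.support
  v_mem : v ∈ Q.support
  u_not : u ∉ Q.support
  v_not : v ∉ P.support

namespace Split

variable {u v z : W} {P Q : T.Walk A B}

theorem symm (h : Split p q u v P Q) : Split p q v u Q P :=
  ⟨h.eq.trans Sym2.eq_swap, h.right, h.left, fun f h1 h2 => h.disj f h2 h1, h.v_mem, h.u_mem,
    h.v_not, h.u_not⟩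

theorem reverse (h : Split p q u v P Q) : Split p q u v P.reverse Q.reverse :=
  ⟨h.eq, h.left.reverse, h.right.reverse, by simpa using h.disj, by simpa using h.u_mem,
    by simpa using h.v_mem, by simpa using h.u_not, by simpa using h.v_not⟩

theorem near (h : Split p q u v P Q) {x : W} (hx : x ∈ s(p, q)) (hxP : x ∈ P.support) : x = u := by
  rw [h.eq, Sym2.mem_iff] at hx
  exact hx.resolve_right fun e => h.v_not (e ▸ hxP)

theorem u_ne_left (h : Split p q u v P Q) : u ≠ A := fun e => h.u_not (e ▸ Q.start_mem_support)

theorem u_ne_right (h : Split p q u v P Q) : u ≠ B := fun e => h.u_not (e ▸ Q.end_mem_support)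

theorem not_crossed [Finite W] (hR : Ear H T p R d d' e e') (hH : Core H p q)
    (hT : MaxCand H p q T) {Pa Qa : T.Walk A z} {Pb Qb : T.Walk z B}
    (h : Split p q u v (Pa.append Pb) (Qa.append Qb)) (hu : u ∈ Pa.support)
    (hv : v ∈ Qb.support) : False := by
  classical
  have hz1 : z ∈ (Pa.append Pb).support := by simp
  have hz2 : z ∈ (Qa.append Qb).support := by simp
  have huz : u ≠ z := fun e => h.u_not (e ▸ hz2)
  have hvz : v ≠ z := fun e => h.v_not (e ▸ hz1)
  let X := (Qa.append Pb).bypass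
  let Y := (Pa.append Qb).bypass
  have hX : X.support ⊆ (Qa.append Pb).support :=
    (Qa.append Pb).support_bypass_subset_support
  have hnd1 := h.left.isTrail.edges_nodup
  have hnd2 := h.right.isTrail.edges_nodup
  have hdisj := h.disj
  simp only [SimpleGraph.Walk.edges_append, List.nodup_append, List.mem_append] at hnd1 hnd2 hdisj
  have hXY : ∀ f ∈ X.edges, f ∉ Y.edges := by
    intro f hf hf'
    have hf := (Qa.append Pb).edges_bypass_subset_edges hf
    have hf' := (Pa.append Qb).edges_bypass_subset_edges hf'
    rw [SimpleGraph.Walk.edges_append, List.mem_append] at hf hf'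
    grind
  have huX : u ∉ X.support := by
    intro hh
    have := hX hh
    rw [SimpleGraph.Walk.mem_support_append_iff] at this
    rcases this with h1 | h1
    · exact h.u_not (by simp [h1])
    · exact huz (eq_of_mem_of_isPath_append h.left hu h1)
  have hvX : v ∉ X.support := by
    intro hh
    have := hX hh
    rw [SimpleGraph.Walk.mem_support_append_iff] at this
    rcases this with h1 | h1
    · exact hvz (eq_of_mem_of_isPath_append h.right h1 hv)
    · exact h.v_not (by simp [h1])
  have hd := hR.dichotomy hH hT (Qa.append Pb).bypass_isPath (Pa.append Qb).bypass_isPath hXY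
  have := h.eq
  rw [Sym2.eq_iff] at this
  grind

theorem not_before (hR : Ear H T p R d d' e e') (hH : Core H p q)
    (hT : MaxCand H p q T) {Pa : T.Walk A z} {Pb : T.Walk z B}
    (h : Split p q u v (Pa.append Pb) Q) (hzQ : z ∈ Q.support) (hu : u ∈ Pa.support)
    (hl : 2 ≤ Pb.length) : False := by
  have huz : u ≠ z := fun e => h.u_not (e ▸ hzQ)
  have hla : 2 ≤ Pa.length := by
    by_contra! hh
    have huA := h.u_ne_left
    rcases Pa with _ | ⟨h1, Pa⟩
    · simp at hu; exact huA hu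
    · rw [SimpleGraph.Walk.length_cons] at hh
      have := SimpleGraph.Walk.eq_of_length_eq_zero (p := Pa) (by omega)
      subst this
      have := SimpleGraph.Walk.length_eq_zero_iff.1 (show Pa.length = 0 by omega)
      rw [SimpleGraph.Walk.eq_nil_iff_nil.2 this] at hu
      simp at hu
      tauto
  have main : ∀ x ∈ Pb.support, x ∉ s(p, q) := by
    intro x hx hxpq
    have := h.near hxpq (by simp [hx])
    subst this
    exact huz (eq_of_mem_of_isPath_append h.left hu hx)
  have hpath := h.left.reverse
  have hlb : Pb.reverse.length = Pb.length := by simp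
  have hs : Pb.reverse.support = Pb.support.reverse := by simp
  rw [SimpleGraph.Walk.reverse_append] at hpath
  rcases hPb : Pb.reverse with _ | ⟨h1, w⟩
  · rw [hPb] at hlb
    simp at hlb
    omega
  · rw [hPb] at hpath hlb hs
    rw [SimpleGraph.Walk.length_cons] at hlb
    rw [SimpleGraph.Walk.cons_append] at hpath
    have hmem : ∀ y, y ∈ (SimpleGraph.Walk.cons h1 w).support → y ∈ Pb.support := by
      intro y hy
      rw [hs] at hy
      simpa using hy
    rcases hR.left.near_cons hH hT h1 _ hpath (by simp; omega) with hh | hh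
    exacts [main _ (hmem _ (by simp)) hh, main _ (hmem _ (by simp)) hh]

theorem not_both_before (hR : Ear H T p R d d' e e') (hH : Core H p q)
    (hT : MaxCand H p q T) {Pa Qa : T.Walk A z} {Pb Qb : T.Walk z B} (hz : z ≠ B)
    (h : Split p q u v (Pa.append Pb) (Qa.append Qb)) (hu : u ∈ Pa.support)
    (hv : v ∈ Qa.support) : False := by
  by_cases h1 : 2 ≤ Pb.length
  · exact not_before hR hH hT h (by simp) hu h1
  by_cases h2 : 2 ≤ Qb.length
  · exact not_before hR hH hT h.symm (by simp) hv h2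
  have hedge : ∀ w : T.Walk z B, ¬ 2 ≤ w.length → s(z, B) ∈ w.edges := by
    intro w hw
    rcases w with _ | ⟨h1, w⟩
    · exact absurd rfl hz
    · rw [SimpleGraph.Walk.length_cons] at hw
      have := SimpleGraph.Walk.eq_of_length_eq_zero (p := w) (by omega)
      subst this
      simp
  exact h.disj s(z, B) (by simp [hedge Pb h1]) (by simp [hedge Qb h2])

theorem disjoint [Finite W] (h : Split p q u v P Q) (hR : Ear H T p R d d' e e')
    (hH : Core H p q) (hT : MaxCand H p q T) (hzP : z ∈ P.support) (hzQ : z ∈ Q.support) :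
    z = A ∨ z = B := by
  classical
  by_contra! hz
  obtain ⟨Pa, Pb, rfl⟩ : ∃ (Pa : T.Walk A z) (Pb : T.Walk z B), P = Pa.append Pb :=
    ⟨_, _, (P.take_spec hzP).symm⟩
  obtain ⟨Qa, Qb, rfl⟩ : ∃ (Qa : T.Walk A z) (Qb : T.Walk z B), Q = Qa.append Qb :=
    ⟨_, _, (Q.take_spec hzQ).symm⟩
  have hu := h.u_mem
  have hv := h.v_mem
  rw [SimpleGraph.Walk.mem_support_append_iff] at hu hv
  rcases hu with hu | hu <;> rcases hv with hv | hv
  · exact not_both_before hR hH hT hz.2 h hu hv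
  · exact not_crossed hR hH hT h hu hv
  · exact not_crossed hR hH hT h.symm hv hu
  · have h' := h.reverse
    rw [SimpleGraph.Walk.reverse_append, SimpleGraph.Walk.reverse_append] at h'
    exact not_both_before hR.symm hH hT hz.1 h' (by simpa using hu) (by simpa using hv)

theorem two_le [Finite W] (hR : Ear H T p R d d' e e') (hT : MaxCand H p q T)
    (P : T.Walk A B) : 2 ≤ P.length := by
  by_contra! hl
  interval_cases h : P.length
  · exact hR.ne (SimpleGraph.Walk.eq_of_length_eq_zero h)
  · exact hR.not_adj hT (hT.le (SimpleGraph.Walk.adj_of_length_eq_one h))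

theorem length_le [Finite W] (h : Split p q u v P Q) (hR : Ear H T p R d d' e e')
    (hH : Core H p q) (hT : MaxCand H p q T) : P.length ≤ 3 := by
  by_contra! hl
  have hdis := fun z => h.disjoint (z := z) hR hH hT
  have hQl := two_le hR hT Q
  obtain ⟨x₁, h₁, P₁, rfl⟩ : ∃ x₁, ∃ (h₁ : T.Adj A x₁) (P₁ : T.Walk x₁ B), P = .cons h₁ P₁ := by
    cases P with
    | nil => simp at hl
    | cons hc P => exact ⟨_, hc, P, rfl⟩
  obtain ⟨x₂, h₂, P₂, rfl⟩ : ∃ x₂, ∃ (h₂ : T.Adj x₁ x₂) (P₂ : T.Walk x₂ B), P₁ = .cons h₂ P₂ := by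
    cases P₁ with
    | nil => simp at hl
    | cons hc P => exact ⟨_, hc, P, rfl⟩
  obtain ⟨x₃, h₃, P₃, rfl⟩ : ∃ x₃, ∃ (h₃ : T.Adj x₂ x₃) (P₃ : T.Walk x₃ B), P₂ = .cons h₃ P₃ := by
    cases P₂ with
    | nil => simp at hl
    | cons hc P => exact ⟨_, hc, P, rfl⟩
  obtain ⟨x₄, h₄, P₄, rfl⟩ : ∃ x₄, ∃ (h₄ : T.Adj x₃ x₄) (P₄ : T.Walk x₄ B), P₃ = .cons h₄ P₄ := by
    cases P₃ with
    | nil => simp at hl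
    | cons hc P => exact ⟨_, hc, P, rfl⟩
  have hnd := h.left.support_nodup
  have hx₄ : x₄ ∈ P₄.support := P₄.start_mem_support
  have m₁ := (hR.left.near_cons hH hT h₂ ((SimpleGraph.Walk.cons h₃ (.cons h₄ P₄)).append
    Q.reverse) (by
      rw [← SimpleGraph.Walk.cons_append]
      refine isPath_append h.left.of_cons h.right.reverse fun z hz hz' => ?_
      rcases hdis z (by simp at hz ⊢; tauto) (by simpa using hz') with rfl | rfl
      · have := h.left
        rw [SimpleGraph.Walk.cons_isPath_iff] at this
        exact absurd hz this.2
      · rfl) (by simp; omega)).imp (fun m => h.near m (by simp)) (fun m => h.near m (by simp))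
  have m₂ := (hR.left.near_cons hH hT h₄.symm (.cons h₃.symm (.cons h₂.symm (.cons h₁.symm .nil)))
    (by
      simp only [SimpleGraph.Walk.support_cons, List.nodup_cons, List.mem_cons] at hnd
      simp [SimpleGraph.Walk.cons_isPath_iff]
      grind) (by simp)).imp (fun m => h.near m (by simp)) (fun m => h.near m (by simp))
  simp only [SimpleGraph.Walk.support_cons, List.nodup_cons, List.mem_cons] at hnd
  grind

theorem short (h : Split p q u v P Q) (hH : Core H p q) (hT : T ≤ H) (hP2 : 2 ≤ P.length)
    (hP : P.length ≤ 3) (hQ : Q.length = 2) : False := by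
  have huv : H.Adj u v := by
    have := hH.pq
    rw [← SimpleGraph.mem_edgeSet, h.eq] at this
    exact this
  have hu := h.u_mem
  have hv := h.v_mem
  have huA := h.u_ne_left
  have huB := h.u_ne_right
  have hvA := h.symm.u_ne_left
  have hvB := h.symm.u_ne_right
  have hnear : H.Adj A u ∨ H.Adj B u := by
    rcases P with _ | ⟨h₁, _ | ⟨h₂, _ | ⟨h₃, _ | ⟨h₄, P⟩⟩⟩⟩
    · simp at hP2
    · simp at hP2
    · simp [huA, huB] at hu
      exact Or.inl (hu ▸ hT h₁)
    · simp [huA, huB] at hu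
      rcases hu with rfl | rfl
      exacts [Or.inl (hT h₁), Or.inr (hT h₃.symm)]
    · simp at hP
      omega
  have hnear' : H.Adj A v ∧ H.Adj v B := by
    rcases Q with _ | ⟨h₁, _ | ⟨h₂, _ | ⟨h₃, Q⟩⟩⟩
    · simp at hQ
    · simp at hQ
    · simp [hvA, hvB] at hv
      exact hv ▸ ⟨hT h₁, hT h₂⟩
    · simp at hQ
  rcases hnear with h1 | h1
  · exact hH.tri A u v h1 huv hnear'.1
  · exact hH.tri B u v h1 huv hnear'.2.symm

theorem false [Finite W] (h : Split p q u v P Q) (hR : Ear H T p R d d' e e')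
    (hH : Core H p q) (hT : MaxCand H p q T) : False := by
  have hP2 := two_le hR hT P
  have hQ2 := two_le hR hT Q
  have hP3 := h.length_le hR hH hT
  have hQ3 := h.symm.length_le hR hH hT
  by_cases hQ : Q.length = 2
  · exact h.short hH hT.le hP2 hP3 hQ
  by_cases hP : P.length = 2
  · exact h.symm.short hH hT.le hQ2 hQ3 hP
  have hdis := fun z => h.disjoint (z := z) hR hH hT
  have hP' : P.length = 3 := by omega
  have hQ' : Q.length = 3 := by omega
  clear hP hQ hP2 hQ2 hP3 hQ3
  rcases P with _ | ⟨h₁, _ | ⟨h₂, _ | ⟨h₃, _ | ⟨h₄, P⟩⟩⟩⟩ <;> try simp at hP'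
  rcases Q with _ | ⟨g₁, _ | ⟨g₂, _ | ⟨g₃, _ | ⟨g₄, Q⟩⟩⟩⟩ <;> try simp at hQ'
  rename_i x₁ x₂ y₁ y₂
  have hnd := h.left.support_nodup
  have hnd' := h.right.support_nodup
  have hA : A ∉ s(p, q) := fun m => h.u_ne_left (h.near m (by simp)).symm
  have hB : B ∉ s(p, q) := fun m => h.u_ne_right (h.near m (by simp)).symm
  have d₁ := hdis y₁
  have d₂ := hdis y₂
  simp only [SimpleGraph.Walk.support_cons, SimpleGraph.Walk.support_nil, List.nodup_cons,
    List.mem_cons, List.not_mem_nil, or_false] at hnd hnd' d₁ d₂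
  have m₂ := h.symm.near ((hR.left.near_cons hH hT g₃ (.cons h₃.symm (.cons h₂.symm
    (.cons h₁.symm .nil))) (by simp [SimpleGraph.Walk.cons_isPath_iff]; grind)
    (by simp)).resolve_right hB) (by simp)
  have m₁ := h.symm.near ((hR.right.near_cons hH hT g₁.symm (.cons h₁ (.cons h₂
    (.cons h₃ .nil))) (by simp [SimpleGraph.Walk.cons_isPath_iff]; grind)
    (by simp)).resolve_right hA) (by simp)
  grind

end Split

theorem Core.false [Finite W] (hH : Core H p q) : False := by
  obtain ⟨T, hT⟩ := hH.exists_maxCand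
  obtain ⟨A, B, d, d', e, e', R, hR⟩ := hH.exists_ear hT
  obtain ⟨P, hP⟩ := (hR.left.mem.symm.trans hR.right.mem).exists_isPath
  obtain ⟨Q, hQ⟩ := (reachable_rest_end hT.even hR.ne hP).exists_isPath
  have hdisj : ∀ f ∈ P.edges, f ∉ (Q.mapLe (rest_le P)).edges := by
    intro f hf hf'
    have hf' : f ∈ Q.edges := by simpa using hf'
    induction f with
    | _ x y => exact (rest_adj.1 (Q.adj_of_mem_edges hf')).2 hf
  have hQ' : (Q.mapLe (rest_le P)).IsPath := by simpa using hQ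
  rcases hR.dichotomy hH hT hP hQ' hdisj with ⟨h1, h2, h3, h4⟩ | ⟨h1, h2, h3, h4⟩
  · exact Split.false ⟨rfl, hP, hQ', hdisj, h1, h2, h3, h4⟩ hR hH hT
  · exact Split.false ⟨Sym2.eq_swap, hP, hQ', hdisj, h1, h2, h3, h4⟩ hR hH hT

end

section

variable {V : Type*} {G F : SimpleGraph V}

theorem Seg.exists_walk {a b : V} {l : List V} (h : Seg G a b l) :
    ∃ w : G.Walk a b, w.support = l := by
  have hl : l ≠ [] := by
    rintro rfl
    simpa using h.head
  refine ⟨(SimpleGraph.Walk.ofSupport l hl h.chain).copy ?_ ?_, ?_⟩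
  · have := h.head
    rwa [List.head?_eq_some_head hl, Option.some_inj] at this
  · have := h.last
    rwa [List.getLast?_eq_some_getLast hl, Option.some_inj] at this
  · simp

variable [Fintype V]

theorem ClawOHeavy.clawHeavy [DecidableRel G.Adj] (h : ClawOHeavy G) : ClawHeavy G := by
  intro a b₁ b₂ b₃ h12 h13 h23 h1 h2 h3
  by_cases g12 : G.Adj b₁ b₂
  · exact Or.inl (le_oGraph G g12)
  by_cases g13 : G.Adj b₁ b₃
  · exact Or.inr (Or.inl (le_oGraph G g13))
  by_cases g23 : G.Adj b₂ b₃
  · exact Or.inr (Or.inr (le_oGraph G g23))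
  obtain ⟨u, v, hu, hv, huv, hadj, hd⟩ := h a b₁ b₂ b₃ h12 h13 h23 h1 h2 h3 g12 g13 g23
  have key : (oGraph G).Adj u v := Or.inr ⟨huv, by rwa [← degree_eq_dg, ← degree_eq_dg]⟩
  simp only [Set.mem_insert_iff, Set.mem_singleton_iff] at hu hv
  have h1' := h1.symm
  have h2' := h2.symm
  have h3' := h3.symm
  rcases hu with rfl | rfl | rfl | rfl <;> rcases hv with rfl | rfl | rfl | rfl <;>
    first
      | exact absurd rfl huv
      | exact absurd ‹_› hadj
      | exact Or.inl key
      | exact Or.inl key.symm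
      | exact Or.inr (Or.inl key)
      | exact Or.inr (Or.inl key.symm)
      | exact Or.inr (Or.inr key)
      | exact Or.inr (Or.inr key.symm)

theorem TwoConnected.connIn (h : TwoConnected G) {v a b : V} (ha : a ≠ v) (hb : b ≠ v) :
    ConnIn G {v}ᶜ a b := by
  obtain ⟨w⟩ := (h.2 v).preconnected ⟨a, ha⟩ ⟨b, hb⟩
  have key : ∀ {a b : ({v}ᶜ : Set V)} (w : (G.induce ({v}ᶜ : Set V)).Walk a b),
      ConnIn G {v}ᶜ a b := by
    intro a b w
    induction w with
    | nil => exact .refl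
    | @cons a c b h _ ih => exact .head ⟨h, a.2, c.2⟩ ih
  exact key w

theorem TwoConnected.exists_ne_ne (h : TwoConnected G) (a b : V) : ∃ v, v ≠ a ∧ v ≠ b := by
  classical
  by_contra! hab
  have := Finset.card_le_card (show (Finset.univ : Finset V) ⊆ {a, b} by
    intro v _
    have := hab v
    simp
    tauto)
  rw [Finset.card_univ] at this
  have := Finset.card_le_two (a := a) (b := b)
  have := h.1
  omega

theorem TwoConnected.exists_adj (h : TwoConnected G) (v : V) : ∃ w, G.Adj v w := by
  obtain ⟨u, huv, -⟩ := h.exists_ne_ne v v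
  obtain ⟨x, hxv, hxu⟩ := h.exists_ne_ne v u
  rcases (h.connIn hxv.symm hxu.symm).cases_head with rfl | ⟨c, hc, -⟩
  exacts [absurd rfl huv, ⟨c, hc.1⟩]

theorem HamL.isHamiltonian [DecidableEq V] (h3 : 3 ≤ Fintype.card V) (h : HamL G) :
    G.IsHamiltonian := by
  intro _
  obtain ⟨a, b, l, hl, hs, hba⟩ := h
  have hlen := hs.length
  obtain ⟨w, rfl⟩ := hl.exists_walk
  have hw : w.IsPath := .mk' hs.1
  rw [SimpleGraph.Walk.length_support] at hlen
  refine ⟨b, .cons hba w, (SimpleGraph.Walk.cons_isCycle_iff _ _).2 ⟨hw, fun he => ?_⟩, ?_⟩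
  · have := hw.length_eq_one_of_mem_edges (Sym2.eq_swap ▸ he)
    omega
  · exact fun v => by simpa using hw.isHamiltonian_of_mem hs.2 v

variable {W : Type*} [Finite W] {φ : V → Sym2 W} {m : V} {p q : W}

/-- The root graph of a nonhamiltonian closure of a 2-connected graph. -/
theorem LineRep.core (hφ : LineRep F φ) (h2 : TwoConnected G) (hGF : G ≤ F) (hF : ¬ HamL F)
    (hstar : ∀ (N : ℕ) (z : ℕ → V), 5 ≤ N → (∀ i j, i ≤ N → j ≤ N → z i = z j → i = j) →
      (∀ i j, i ≤ N → j ≤ N → (F.Adj (z i) (z j) ↔ i + 1 = j ∨ j + 1 = i)) →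
      (z 0 = m ∨ F.Adj m (z 0)) ∨ (z N = m ∨ F.Adj m (z N)))
    (hm : φ m = s(p, q))
    (hpend : (∀ y, (rootGraph φ).Adj p y → y = q) → ∀ y, (rootGraph φ).Adj q y → y = p) :
    Core (rootGraph φ) p q where
  pq := hφ.root_adj.2 ⟨m, hm⟩
  tri _ _ _ := hφ.triangle_free
  conn x y x' y' hx hy := by
    obtain ⟨c, hc⟩ := hφ.root_adj.1 hx
    obtain ⟨d, hd⟩ := hφ.root_adj.1 hy
    obtain ⟨v, hvc, hvd⟩ := h2.exists_ne_ne c d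
    exact (hφ.reachable_avoiding hvc.symm
      (Relation.ReflTransGen.mono (fun _ _ h => ⟨hGF h.1, h.2⟩) _ _ (h2.connIn hvc.symm hvd.symm))
      (by simp [hc]) (by simp [hd])).mono (SimpleGraph.deleteEdges_le _)
  bridge a b x x' y y' hab hx hy hxab hyab := by
    obtain ⟨v, hv⟩ := hφ.root_adj.1 hab
    obtain ⟨c, hc⟩ := hφ.root_adj.1 hx
    obtain ⟨d, hd⟩ := hφ.root_adj.1 hy
    have hcv : c ≠ v := by rintro rfl; exact hxab (hc ▸ hv)
    have hdv : d ≠ v := by rintro rfl; exact hyab (hd ▸ hv)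
    rw [← hv]
    exact hφ.reachable_avoiding hcv
      (Relation.ReflTransGen.mono (fun _ _ h => ⟨hGF h.1, h.2⟩) _ _ (h2.connIn hcv hdv))
      (by simp [hc]) (by simp [hd])
  star x y x' y' w hw hl hx hy hx' hy' hxy := by
    have := hφ.end_near_of_path hstar (.cons hx.symm (w.concat hy))
      ((hw.concat hy' hy).cons (by simp [SimpleGraph.Walk.support_concat, hx', hxy]))
      (by simp; omega)
    simpa [hm, SimpleGraph.Walk.concat_eq_append, SimpleGraph.Walk.getVert_append] using this
  pend := hpend
  dom T hT hpar := by
    by_contra! hcon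
    obtain ⟨x, c, hc, -, hmem⟩ := exists_closed_trail T hpar p
    refine hF (hφ.hamL_of_closed_trail h2.1 (c.mapLe hT) (by simpa using hc) fun v => ?_)
    rcases hv : φ v with ⟨y, y'⟩
    by_cases hy : T.Reachable p y
    · exact ⟨y, by simpa using hmem y hy, by simp⟩
    · exact ⟨y', by simpa using hmem y' (hcon y y' (hφ.root_adj.2 ⟨v, hv⟩) hy), by simp⟩

end

/-- Every 2-connected claw-o-heavy and `P₆`-`γ2`-heavy graph is hamiltonian. -/
theorem stmt_2 {V : Type*} [Fintype V] [DecidableEq V] (G : SimpleGraph V) [DecidableRel G.Adj]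
    (h2conn : TwoConnected G) (hclaw : ClawOHeavy G)
    (hP6 : P6GammaHeavy G gamma2) :
    G.IsHamiltonian := by
  refine HamL.isHamiltonian h2conn.1 ?_
  by_contra hn
  have hG := hclaw.clawHeavy
  obtain ⟨F, hF⟩ := exists_closed h2conn.1 hG hn
  obtain ⟨φ, hφ⟩ := hF.exists_lineRep fun v =>
    (h2conn.exists_adj v).imp fun _ h => hF.le h
  have : Nonempty V := Fintype.card_pos_iff.1 (by have := h2conn.1; omega)
  obtain ⟨m, hm⟩ := Finite.exists_max (dg G)
  rcases hpq : φ m with ⟨p, q⟩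
  have hstar := fun N z hN => hF.end_near_of_induced_path hG hP6 hm (z := z) (N := N) hN
  by_cases hp : ∀ y, (rootGraph φ).Adj p y → y = q
  · exact (hφ.core h2conn hF.le hF.not_ham hstar (hpq.trans Sym2.eq_swap) fun _ => hp).false
  · exact (hφ.core h2conn hF.le hF.not_ham hstar hpq fun h => absurd h hp).false
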